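/- Let m ≥ 4 and let f_{k,α,β} be an APN Taniguchi function on F_{2^m} × F_{2^m}. If α ≠ 0, set β' = β·α^{-(2^{m-k}+1)} and u₀ = min{u ≥ 1 : β'^{2^u} = β'}. Then: if α ≠ 0, |Aut_EL(f_{k,α,β})| = m(2^m−1)/u₀ and |Aut(f_{k,α,β})| = m·2^{2m}(2^m−1)/u₀; if α = 0 and m = 4, |Aut_EL(f_{k,0,β})| = 3m(2^m−1) and |Aut(f_{k,0,β})| = 3m·2^{2m}(2^m−1); if α = 0 and m ≥ 5, |Aut_EL(f_{k,0,β})| = (3/2)m(2^m−1) and |Aut(f_{k,0,β})| = 3m·2^{2m−1}(2^m−1). -/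

import Mathlib

/-- The Taniguchi function `f_{k,α,β}` on `K × K`. -/
def taniguchi {K : Type*} [Field K] (k : ℕ) (α β : K) : K × K → K × K :=
  fun p => (p.1 ^ (2 ^ (2 * k) * (2 ^ k + 1)) + α * p.1 ^ (2 ^ (2 * k)) * p.2 ^ (2 ^ k)
      + β * p.2 ^ (2 ^ k + 1), p.1 * p.2)

/-- The graph `{(x, f x)}` of a function. -/
def graphOf {V : Type*} (f : V → V) : Set (V × V) := {p | p.2 = f p.1}

/-- An affine permutation of an `F_2`-vector space: an `F_2`-linear bijection composed
with a translation. -/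
def IsAffinePerm {W : Type*} [AddCommGroup W] [Module (ZMod 2) W] (A : W → W) : Prop :=
  ∃ Lin : W → W, IsLinearMap (ZMod 2) Lin ∧ Function.Bijective Lin ∧
    ∃ c : W, ∀ w, A w = Lin w + c

/-- `Aut(f)`: the affine permutations of `V × V` preserving the graph of `f`. -/
def AutSet {V : Type*} [AddCommGroup V] [Module (ZMod 2) V] (f : V → V) :
    Set ((V × V) → (V × V)) :=
  {A | IsAffinePerm A ∧ A '' graphOf f = graphOf f}

/-- `Aut_EL(f)`: the linear permutations of `V × V` of the shape
`(x, y) ↦ (L x, M x + N y)` (with `L, N` linear bijections and `M` linear) preserving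
the graph of `f`. -/
def AutELSet {V : Type*} [AddCommGroup V] [Module (ZMod 2) V] (f : V → V) :
    Set ((V × V) → (V × V)) :=
  {A | (∃ L M N : V → V,
        IsLinearMap (ZMod 2) L ∧ IsLinearMap (ZMod 2) M ∧ IsLinearMap (ZMod 2) N ∧
        Function.Bijective L ∧ Function.Bijective N ∧
        ∀ p : V × V, A p = (L p.1, M p.1 + N p.2)) ∧
      A '' graphOf f = graphOf f}

namespace Tani

section Abstract

open Module

variable {V : Type*} [AddCommGroup V] [Module (ZMod 2) V] [Finite V]

lemma zmod2_cases (c : ZMod 2) : c = 0 ∨ c = 1 := by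
  revert c; decide

lemma add_self_zero {W : Type*} [AddCommGroup W] [Module (ZMod 2) W] (x : W) : x + x = 0 := by
  have h : (2 : ZMod 2) • x = 0 := by
    rw [show (2 : ZMod 2) = 0 from rfl, zero_smul]
  rwa [two_smul] at h

lemma eq_of_add_zero {W : Type*} [AddCommGroup W] [Module (ZMod 2) W] {x y : W}
    (h : x + y = 0) : x = y := by
  have h2 : x + y + y = y := by rw [h, zero_add]
  rwa [add_assoc, add_self_zero, add_zero] at h2

/-- For alternating forms, the codimension of the radical is even. -/
lemma even_radical (ω : LinearMap.BilinForm (ZMod 2) V) (halt : ∀ x, ω x x = 0) :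
    Even (finrank (ZMod 2) V + finrank (ZMod 2) (LinearMap.ker ω)) := by
  have hsymm : ∀ x y, ω x y = ω y x := by
    intro x y
    have h := halt (x + y)
    simp only [map_add, LinearMap.add_apply, halt, zero_add, add_zero] at h
    exact (eq_of_add_zero h).symm
  have : Finite (Submodule (ZMod 2) V) := inferInstance
  obtain ⟨U, hU, hmax⟩ := Set.Finite.exists_maximal
    (Set.toFinite {U : Submodule (ZMod 2) V | ∀ x ∈ U, ∀ y ∈ U, ω x y = 0})
    ⟨⊥, by
      intro x hx y hy
      rw [Submodule.mem_bot] at hx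
      rw [hx]; simp⟩
  have key : ∀ v, (∀ x ∈ U, ω x v = 0) → v ∈ U := by
    intro v hv
    have hmem : (U ⊔ Submodule.span (ZMod 2) {v}) ∈
        {U : Submodule (ZMod 2) V | ∀ x ∈ U, ∀ y ∈ U, ω x y = 0} := by
      intro x hx y hy
      rw [Submodule.mem_sup] at hx hy
      obtain ⟨x1, hx1, x2, hx2, rfl⟩ := hx
      obtain ⟨y1, hy1, y2, hy2, rfl⟩ := hy
      rw [Submodule.mem_span_singleton] at hx2 hy2
      obtain ⟨a, rfl⟩ := hx2
      obtain ⟨b, rfl⟩ := hy2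
      simp [hU x1 hx1 y1 hy1, hv x1 hx1, hsymm v y1, hv y1 hy1, halt]
    have := hmax hmem le_sup_left
    exact this (Submodule.mem_sup_right (Submodule.mem_span_singleton_self v))
  have horth : ω.orthogonal U = U := by
    ext v
    rw [LinearMap.BilinForm.mem_orthogonal_iff]
    constructor
    · intro h; exact key v (fun x hx => h x hx)
    · intro h x hx; exact hU x hx v h
  have hker : U ⊓ LinearMap.ker ω = LinearMap.ker ω := by
    apply inf_eq_right.mpr
    intro v hv
    apply key
    intro x _
    rw [hsymm, LinearMap.mem_ker.mp hv]; rfl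
  have h := LinearMap.BilinForm.finrank_add_finrank_orthogonal' (B := ω) U
  rw [horth, hker] at h
  rw [← h]
  exact ⟨_, rfl⟩

lemma isotropic_bound (ω : LinearMap.BilinForm (ZMod 2) V) (E : Submodule (ZMod 2) V)
    (hE : ∀ x ∈ E, ∀ y ∈ E, ω x y = 0) :
    2 * finrank (ZMod 2) E ≤ finrank (ZMod 2) V +
      finrank (ZMod 2) (E ⊓ LinearMap.ker ω : Submodule (ZMod 2) V) := by
  have h := LinearMap.BilinForm.finrank_add_finrank_orthogonal' (B := ω) E
  have hle : E ≤ ω.orthogonal E := by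
    intro v hv
    rw [LinearMap.BilinForm.mem_orthogonal_iff]
    intro x hx
    exact hE x hx v hv
  have h2 := Submodule.finrank_mono hle
  omega

/-- The unique functional killing the image of `B a`. -/
lemma functional_unique (B : V →ₗ[ZMod 2] V →ₗ[ZMod 2] V)
    (hAPN : ∀ a, a ≠ 0 → ∀ x, B a x = 0 → x = 0 ∨ x = a) (halt : ∀ a, B a a = 0)
    (a : V) (ha : a ≠ 0) (b b' : Dual (ZMod 2) V) (hb : b ≠ 0) (hb' : b' ≠ 0)
    (h : ∀ x, b (B a x) = 0) (h' : ∀ x, b' (B a x) = 0) : b = b' := by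
  have hker : LinearMap.ker (B a) = Submodule.span (ZMod 2) {a} := by
    ext x
    rw [LinearMap.mem_ker, Submodule.mem_span_singleton]
    constructor
    · intro hx
      rcases hAPN a ha x hx with rfl | rfl
      · exact ⟨0, by simp⟩
      · exact ⟨1, by simp⟩
    · rintro ⟨c, rfl⟩
      simp [halt]
  have h1 : finrank (ZMod 2) (LinearMap.ker (B a)) = 1 := by
    rw [hker]; exact finrank_span_singleton ha
  have h2 := LinearMap.finrank_range_add_finrank_ker (B a)
  have h3 := Subspace.finrank_add_finrank_dualAnnihilator_eq (LinearMap.range (B a))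
  have h4 : finrank (ZMod 2) (LinearMap.range (B a)).dualAnnihilator = 1 := by omega
  have hbm : b ∈ (LinearMap.range (B a)).dualAnnihilator := by
    rw [Submodule.mem_dualAnnihilator]
    rintro _ ⟨x, rfl⟩; exact h x
  have hbm' : b' ∈ (LinearMap.range (B a)).dualAnnihilator := by
    rw [Submodule.mem_dualAnnihilator]
    rintro _ ⟨x, rfl⟩; exact h' x
  have h5 := (finrank_eq_one_iff_of_nonzero'
    (⟨b, hbm⟩ : (LinearMap.range (B a)).dualAnnihilator)
    (by intro h; exact hb (congrArg Subtype.val h))).mp h4 ⟨b', hbm'⟩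
  obtain ⟨c, hc⟩ := h5
  have hc' : c • b = b' := congrArg Subtype.val hc
  rcases zmod2_cases c with rfl | rfl
  · rw [zero_smul] at hc'; exact absurd hc'.symm hb'
  · rwa [one_smul] at hc'

lemma card_sub (S : Type*) [AddCommGroup S] [Module (ZMod 2) S] [Finite S] :
    Nat.card S = 2 ^ finrank (ZMod 2) S := by
  rw [Module.natCard_eq_pow_finrank (K := ZMod 2), Nat.card_zmod]

lemma arith_final (m e s : ℕ) (h1 : m + 1 ≤ e) (h2 : e + 1 ≤ 2 * m) (h3 : 2 * m + 1 ≤ e + s)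
    (h : (2 ^ s - 1) * (2 ^ (2 * e - 2 * m) - 1) ≤ 2 ^ e - 1) : False := by
  obtain ⟨i, rfl⟩ := Nat.exists_eq_add_of_le h1
  obtain ⟨j, hj⟩ := Nat.exists_eq_add_of_le h2
  have hm : m = i + j + 2 := by omega
  subst hm
  have hs : j + 2 ≤ s := by omega
  have e1 : 2 * (i + j + 2 + 1 + i) - 2 * (i + j + 2) = 2 * i + 2 := by omega
  rw [e1] at h
  have e2 : (2 ^ (j + 2) - 1) * (2 ^ (2 * i + 2) - 1) ≤ (2 ^ s - 1) * (2 ^ (2 * i + 2) - 1) := by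
    apply Nat.mul_le_mul_right
    apply Nat.sub_le_sub_right
    exact Nat.pow_le_pow_right (by norm_num) hs
  have h := e2.trans h
  have p1 : 1 ≤ 2 ^ i := Nat.one_le_two_pow
  have p2 : 1 ≤ 2 ^ j := Nat.one_le_two_pow
  have q1 : 2 ^ (2 * i + 2) = 4 * (2 ^ i * 2 ^ i) := by ring
  have q2 : 2 ^ (j + 2) = 4 * 2 ^ j := by ring
  have q3 : 2 ^ (i + j + 2 + 1 + i) = 8 * (2 ^ i * 2 ^ i) * 2 ^ j := by ring
  rw [q1, q2, q3] at h
  generalize 2 ^ i = a at *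
  generalize 2 ^ j = b at *
  have ha : 1 ≤ a * a := Nat.mul_pos p1 p1
  generalize a * a = c at *
  obtain ⟨c', rfl⟩ := Nat.exists_eq_add_of_le ha
  obtain ⟨b', rfl⟩ := Nat.exists_eq_add_of_le p2
  have r1 : 4 * (1 + b') - 1 = 3 + 4 * b' := by omega
  have r2 : 4 * (1 + c') - 1 = 3 + 4 * c' := by omega
  have r3 : 8 * (1 + c') * (1 + b') - 1 = 7 + 8 * b' + 8 * c' + 8 * (c' * b') := by
    have : 8 * (1 + c') * (1 + b') = 8 + 8 * b' + 8 * c' + 8 * (c' * b') := by ring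
    omega
  rw [r1, r2, r3] at h
  have : (3 + 4 * b') * (3 + 4 * c') = 9 + 12 * b' + 12 * c' + 16 * (c' * b') := by ring
  omega

theorem ccz_is_el (m : ℕ) (hdim : finrank (ZMod 2) V = 2 * m)
    (f : V → V) (B : V →ₗ[ZMod 2] V →ₗ[ZMod 2] V)
    (hf : ∀ x y, f (x + y) = f x + f y + B x y)
    (hAPN : ∀ a, a ≠ 0 → ∀ x, B a x = 0 → x = 0 ∨ x = a)
    (P : Submodule (ZMod 2) (Dual (ZMod 2) V)) (hP : finrank (ZMod 2) P = m)
    (hbent : ∀ c ∈ P, c ≠ 0 → ∀ a, (∀ x, c (B a x) = 0) → a = 0)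
    (hnz : ∀ c : Dual (ZMod 2) V, (∀ a x, c (B a x) = 0) → c = 0)
    (A1 A2 A3 A4 : V →ₗ[ZMod 2] V)
    (hinj : Function.Injective (fun x => A1 x + A2 (f x)))
    (hgr : ∀ x, f (A1 x + A2 (f x)) = A3 x + A4 (f x))
    (hsurj : ∀ v, ∃ x y, A1 x + A2 y = v) : A2 = 0 := by
  classical
  have hf0 : f 0 = 0 := by
    have := hf 0 0
    simp only [add_zero, map_zero] at this
    rwa [add_self_zero] at this
  have halt : ∀ a, B a a = 0 := by
    intro a
    have := hf a a
    rw [add_self_zero, add_self_zero, hf0, zero_add] at this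
    exact this.symm
  have hsym : ∀ x y, B x y = B y x := by
    intro x y
    have h1 := hf x y
    rw [add_comm x y, hf y x, add_comm (f y)] at h1
    exact (add_left_cancel h1).symm
  set φ : V → V := fun x => A1 x + A2 (f x) with hφ
  have hφadd : ∀ x y, φ (x + y) = φ x + φ y + A2 (B x y) := by
    intro x y
    simp only [hφ, hf, map_add]; abel
  have hφ0 : φ 0 = 0 := by simp [hφ, hf0]
  have hφne : ∀ x, x ≠ 0 → φ x ≠ 0 := by
    intro x hx h
    exact hx (hinj (by rw [h, hφ0]))
  have hgr' : ∀ x, f (φ x) = A3 x + A4 (f x) := hgr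
  have finDual : Finite (Dual (ZMod 2) V) := Module.finite_of_finite (ZMod 2)
  by_contra hA2
  -- the subspace D
  let D' := LinearMap.range A2
  let D := D'.comap A1
  have hφD : ∀ x, φ x ∈ D' ↔ x ∈ D := by
    intro x
    have : A2 (f x) ∈ D' := ⟨_, rfl⟩
    change A1 x + A2 (f x) ∈ D' ↔ A1 x ∈ D'
    exact Submodule.add_mem_iff_left _ this
  clear_value φ
  let S := LinearMap.range A2.dualMap
  have hS : finrank (ZMod 2) S = finrank (ZMod 2) D' :=
    LinearMap.finrank_range_dualMap_eq_finrank_range A2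
  have hDcard : finrank (ZMod 2) D = finrank (ZMod 2) D' := by
    have h1 : LinearMap.range (D'.mkQ ∘ₗ A1) = ⊤ := by
      rw [LinearMap.range_eq_top]
      intro v
      obtain ⟨v, rfl⟩ := D'.mkQ_surjective v
      obtain ⟨x, y, hxy⟩ := hsurj v
      refine ⟨x, ?_⟩
      rw [← hxy]
      simp only [LinearMap.comp_apply, map_add]
      have : D'.mkQ (A2 y) = 0 := by
        rw [Submodule.mkQ_apply, Submodule.Quotient.mk_eq_zero]; exact ⟨y, rfl⟩
      rw [this, add_zero]
    have h2 : LinearMap.ker (D'.mkQ ∘ₗ A1) = D := by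
      rw [LinearMap.ker_comp, Submodule.ker_mkQ]
    have h3 := LinearMap.finrank_range_add_finrank_ker (D'.mkQ ∘ₗ A1)
    rw [h1, h2, finrank_top] at h3
    have h4 := Submodule.finrank_quotient_add_finrank D'
    omega
  -- functionals attached to elements of D
  have hfun : ∀ d ∈ D, d ≠ 0 → ∃ c : Dual (ZMod 2) V, c (φ d) = 1 ∧
      (∀ x, c (A2 (B d x)) = 0) ∧ A2.dualMap c ≠ 0 := by
    intro d hd hd0
    have hnot : φ d ∉ LinearMap.range (A2 ∘ₗ B d) := by
      rintro ⟨x, hx⟩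
      have h1 : φ (x + d) = φ x := by
        rw [hφadd, hsym, ← hx, LinearMap.comp_apply, add_assoc, add_self_zero, add_zero]
      have h2 := hinj h1
      exact hd0 (by simpa using h2)
    obtain ⟨c, hc1, hc2⟩ := Submodule.exists_le_ker_of_notMem hnot
    have hc3 : c (φ d) = 1 := by
      rcases zmod2_cases (c (φ d)) with h | h
      · exact absurd h hc1
      · exact h
    refine ⟨c, hc3, fun x => hc2 ⟨x, rfl⟩, ?_⟩
    intro h0
    obtain ⟨y, hy⟩ := (hφD d).mpr hd
    have : A2.dualMap c y = 0 := by rw [h0]; rfl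
    rw [LinearMap.dualMap_apply, hy, hc3] at this
    exact one_ne_zero this
  choose! g hg1 hg2 hg3 using hfun
  have huniq := functional_unique B hAPN halt
  have hginj : ∀ d1 ∈ D, d1 ≠ 0 → ∀ d2 ∈ D, d2 ≠ 0 →
      A2.dualMap (g d1) = A2.dualMap (g d2) → d1 = d2 := by
    intro d1 h1 n1 d2 h2 n2 heq
    by_contra hne
    have h3 : d1 + d2 ∈ D := D.add_mem h1 h2
    have n3 : d1 + d2 ≠ 0 := fun h => hne (eq_of_add_zero h)
    have e1 : ∀ y, (g d1) (A2 y) = (g d2) (A2 y) := fun y => by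
      have := congrArg (fun t => t y) heq
      simpa using this
    have heq3 : A2.dualMap (g d1) = A2.dualMap (g (d1 + d2)) := by
      apply huniq (d1 + d2) n3 _ _ (hg3 _ h1 n1) (hg3 _ h3 n3)
      · intro x
        rw [LinearMap.dualMap_apply, map_add, LinearMap.add_apply, map_add, map_add,
          hg2 _ h1 n1, e1, hg2 _ h2 n2, add_zero]
      · intro x; exact hg2 _ h3 n3 x
    have e3 : ∀ y, (g d1) (A2 y) = (g (d1 + d2)) (A2 y) := fun y => by
      have := congrArg (fun t => t y) heq3
      simpa using this
    have v3 := hg1 _ h3 n3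
    obtain ⟨y2, hy2⟩ := (hφD d2).mpr h2
    obtain ⟨y3, hy3⟩ := (hφD _).mpr h3
    rw [← hy3, ← e3, hy3, hφadd, map_add, map_add, hg1 _ h1 n1, hg2 _ h1 n1, ← hy2, e1, hy2,
      hg1 _ h2 n2] at v3
    exact absurd v3 (by decide)
  -- surjectivity
  have hcards : Nat.card {d : D // d ≠ 0} = Nat.card {b : S // b ≠ 0} := by
    have := Fintype.ofFinite D
    have := Fintype.ofFinite S
    have c1 : Nat.card D = Nat.card S := by rw [card_sub, card_sub, hDcard, hS]
    rw [Nat.card_eq_fintype_card, Nat.card_eq_fintype_card] at c1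
    rw [Nat.card_eq_fintype_card, Nat.card_eq_fintype_card, Fintype.card_subtype_compl,
      Fintype.card_subtype_compl, c1]
    simp
  let G : {d : D // d ≠ 0} → {b : S // b ≠ 0} := fun d =>
    ⟨⟨A2.dualMap (g d.1.1), ⟨_, rfl⟩⟩, fun h => hg3 d.1.1 d.1.2 (fun h' => d.2 (Subtype.ext h'))
      (congrArg Subtype.val h)⟩
  have hGinj : Function.Injective G := by
    intro d1 d2 h
    have h' : A2.dualMap (g d1.1.1) = A2.dualMap (g d2.1.1) :=
      congrArg (fun t => t.1.1) h
    have := hginj d1.1.1 d1.1.2 (fun h' => d1.2 (Subtype.ext h')) d2.1.1 d2.1.2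
      (fun h' => d2.2 (Subtype.ext h')) h'
    exact Subtype.ext (Subtype.ext this)
  have hGsurj : Function.Surjective G :=
    ((Nat.bijective_iff_injective_and_card G).mpr ⟨hGinj, hcards⟩).2
  have hex : ∀ b ∈ S, b ≠ 0 → ∃ d ∈ D, d ≠ 0 ∧ A2.dualMap (g d) = b := by
    intro b hb hb0
    obtain ⟨d, hd⟩ := hGsurj ⟨⟨b, hb⟩, fun h => hb0 (congrArg Subtype.val h)⟩
    exact ⟨d.1.1, d.1.2, fun h' => d.2 (Subtype.ext h'), congrArg (fun t => t.1.1) hd⟩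
  have hrad : ∀ b ∈ S, b ≠ 0 → ∃ d ∈ D, d ≠ 0 ∧ (∀ x, b (B d x) = 0) ∧
      ∀ d' ∈ D, (∀ x, b (B d' x) = 0) → d' = 0 ∨ d' = d := by
    intro b hb hb0
    obtain ⟨d, hd, hd0, hgd⟩ := hex b hb hb0
    refine ⟨d, hd, hd0, fun x => by rw [← hgd]; exact hg2 d hd hd0 x, ?_⟩
    intro d' hd' hk
    by_cases h0 : d' = 0
    · exact Or.inl h0
    right
    apply hginj d' hd' h0 d hd hd0
    rw [hgd]
    exact huniq d' h0 _ _ (hg3 _ hd' h0) hb0 (fun x => hg2 _ hd' h0 x) hk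
  -- s ≤ m
  have hsm : finrank (ZMod 2) S ≤ m := by
    have hdisj : S ⊓ P = ⊥ := by
      rw [eq_bot_iff]
      rintro b ⟨hb1, hb2⟩
      rw [Submodule.mem_bot]
      by_contra hb0
      obtain ⟨d, _, hd0, hk, _⟩ := hrad b hb1 hb0
      exact hd0 (hbent b hb2 hb0 d hk)
    have h1 := Submodule.finrank_sup_add_finrank_inf_eq S P
    rw [hdisj, finrank_bot, hP] at h1
    have h2 := Submodule.finrank_le (S ⊔ P)
    rw [Subspace.dual_finrank_eq, hdim] at h2
    omega
  -- a nonzero functional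
  obtain ⟨c0, hc0⟩ : ∃ c0, A2.dualMap c0 ≠ 0 := by
    by_contra hcon
    push Not at hcon
    apply hA2
    ext y
    rw [LinearMap.zero_apply, ← Module.forall_dual_apply_eq_zero_iff (ZMod 2)]
    intro c
    have := congrArg (fun t => t y) (hcon c)
    simpa using this
  obtain ⟨d0, hd0, hd00, hk0, hu0⟩ := hrad _ ⟨c0, rfl⟩ hc0
  let ω : Dual (ZMod 2) V → LinearMap.BilinForm (ZMod 2) V := fun b => B.compr₂ b
  have hω : ∀ b x y, ω b x y = b (B x y) := fun b x y => rfl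
  have hωker : ∀ b x, x ∈ LinearMap.ker (ω b) ↔ ∀ y, b (B x y) = 0 := by
    intro b x
    rw [LinearMap.mem_ker]
    constructor
    · intro h y; rw [← hω, h]; rfl
    · intro h; ext y; exact h y
  obtain ⟨q, hqD, hq⟩ : ∃ q, q ∉ D ∧ ∀ x, A2.dualMap c0 (B q x) = 0 := by
    by_contra hcon
    push Not at hcon
    have hspan : LinearMap.ker (ω (A2.dualMap c0)) = Submodule.span (ZMod 2) {d0} := by
      ext x
      rw [hωker, Submodule.mem_span_singleton]
      constructor
      · intro hx
        have hxD : x ∈ D := by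
          by_contra hxD
          obtain ⟨y, hy⟩ := hcon x hxD
          exact hy (hx y)
        rcases hu0 x hxD hx with rfl | rfl
        · exact ⟨0, by simp⟩
        · exact ⟨1, by simp⟩
      · rintro ⟨c, rfl⟩ y
        rw [map_smul, LinearMap.smul_apply, map_smul, hk0, smul_zero]
    have hev := even_radical (ω (A2.dualMap c0)) (fun x => by rw [hω, halt, map_zero])
    rw [hspan, finrank_span_singleton hd00, hdim] at hev
    rcases hev with ⟨t, ht⟩
    omega
  have hq0 : q ≠ 0 := fun h => hqD (h ▸ D.zero_mem)
  -- isotropic subspace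
  let E := LinearMap.ker (A2 ∘ₗ B q)
  have hEmem : ∀ r, r ∈ E ↔ A2 (B q r) = 0 := fun r => LinearMap.mem_ker
  have hEB : ∀ r ∈ E, B (φ q) (φ r) = A4 (B q r) := by
    intro r hr
    rw [hEmem] at hr
    have h1 : φ (q + r) = φ q + φ r := by rw [hφadd, hr, add_zero]
    have h2 := hgr' (q + r)
    rw [h1, hf (φ q), hf q, map_add A3, map_add A4, map_add A4] at h2
    have h3 := hgr' q
    have h4 := hgr' r
    rw [h3, h4] at h2
    have h5 : A3 q + A4 (f q) + (A3 r + A4 (f r)) + B (φ q) (φ r) =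
      A3 q + A4 (f q) + (A3 r + A4 (f r)) + A4 (B q r) := by
      rw [h2]; abel
    exact add_left_cancel h5
  have hiso : ∀ r ∈ E, ∀ t ∈ E, A2 (B r t) = 0 := by
    intro r hr t ht
    have h1 := hEB (r + t) (E.add_mem hr ht)
    rw [hφadd, map_add, map_add, map_add, map_add, hEB r hr, hEB t ht] at h1
    have h2 : B (φ q) (A2 (B r t)) = 0 := by
      simpa using h1
    rcases hAPN (φ q) (hφne q hq0) _ h2 with h | h
    · exact h
    · exfalso
      apply hqD
      rw [← hφD, ← h]
      exact ⟨_, rfl⟩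
  set e := finrank (ZMod 2) E with he
  set s := finrank (ZMod 2) S with hs
  have hes : 2 * m + 1 ≤ e + s := by
    have h1 := LinearMap.finrank_range_add_finrank_ker (A2 ∘ₗ B q)
    have hlt : LinearMap.range (A2 ∘ₗ B q) < D' := by
      rw [SetLike.lt_iff_le_and_exists]
      refine ⟨LinearMap.range_comp_le_range _ _, ?_⟩
      by_contra hcon
      push Not at hcon
      apply hc0
      ext y
      obtain ⟨x, hx⟩ := hcon (A2 y) ⟨y, rfl⟩
      rw [LinearMap.dualMap_apply, ← hx]
      exact hq x
    have h2 := Submodule.finrank_lt_finrank_of_lt hlt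
    change _ + e = _ at h1
    omega
  have he2 : e + 1 ≤ 2 * m := by
    have h1 : e ≤ finrank (ZMod 2) V := Submodule.finrank_le E
    rcases Nat.lt_or_ge e (2 * m) with h | h
    · exact h
    · exfalso
      have htop : E = ⊤ := by
        apply Submodule.eq_top_of_finrank_eq
        omega
      apply hc0
      apply hnz
      intro a x
      rw [LinearMap.dualMap_apply, hiso a (htop ▸ Submodule.mem_top) x (htop ▸ Submodule.mem_top),
        map_zero]
  have hrb : ∀ b ∈ S, 2 * e - 2 * m ≤
      finrank (ZMod 2) (E ⊓ LinearMap.ker (ω b) : Submodule (ZMod 2) V) := by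
    rintro _ ⟨c, rfl⟩
    have := isotropic_bound (ω (A2.dualMap c)) E (by
      intro x hx y hy
      rw [hω, LinearMap.dualMap_apply, hiso x hx y hy, map_zero])
    omega
  -- counting
  apply arith_final m e s (by omega) he2 hes
  have := Fintype.ofFinite V
  have := Fintype.ofFinite (Dual (ZMod 2) V)
  let SF : Finset (Dual (ZMod 2) V) := Finset.univ.filter (fun b => b ∈ S ∧ b ≠ 0)
  let R : Dual (ZMod 2) V → Finset V := fun b =>
    Finset.univ.filter (fun x => (x ∈ E ⊓ LinearMap.ker (ω b)) ∧ x ≠ 0)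
  have hcardU : ∀ U : Submodule (ZMod 2) V,
      (Finset.univ.filter (fun x => x ∈ U ∧ x ≠ 0)).card = 2 ^ finrank (ZMod 2) U - 1 := by
    intro U
    rw [← card_sub U, Nat.card_eq_fintype_card, Fintype.card_subtype]
    have : (Finset.univ.filter (fun x => x ∈ U ∧ x ≠ 0)) =
        (Finset.univ.filter (fun x => x ∈ U)).erase 0 := by
      ext x; simp [and_comm]
    rw [this, Finset.card_erase_of_mem (by simp)]
  have hSF : SF.card = 2 ^ s - 1 := by
    rw [hs, ← card_sub S, Nat.card_eq_fintype_card, Fintype.card_subtype]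
    have : SF = (Finset.univ.filter (fun x => x ∈ S)).erase 0 := by
      ext x; simp [SF, and_comm]
    rw [this, Finset.card_erase_of_mem (by simp)]
  have hdisj : ∀ b ∈ SF, ∀ b' ∈ SF, b ≠ b' → Disjoint (R b) (R b') := by
    intro b hb b' hb' hne
    rw [Finset.disjoint_left]
    intro x hx hx'
    simp only [R, SF, Finset.mem_filter, Finset.mem_univ, true_and, Submodule.mem_inf,
      hωker] at hx hx' hb hb'
    exact hne (huniq x hx.2 b b' hb.2 hb'.2 hx.1.2 hx'.1.2)
  have hsub : SF.biUnion R ⊆ Finset.univ.filter (fun x => x ∈ E ∧ x ≠ 0) := by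
    intro x hx
    rw [Finset.mem_biUnion] at hx
    obtain ⟨b, _, hx⟩ := hx
    simp only [R, Finset.mem_filter, Finset.mem_univ, true_and, Submodule.mem_inf] at hx ⊢
    exact ⟨hx.1.1, hx.2⟩
  have hle := Finset.card_le_card hsub
  rw [hcardU, Finset.card_biUnion hdisj] at hle
  refine le_trans ?_ hle
  rw [← hSF, ← smul_eq_mul]
  apply Finset.card_nsmul_le_sum
  intro b hb
  simp only [SF, Finset.mem_filter, Finset.mem_univ, true_and] at hb
  change _ ≤ (Finset.univ.filter (fun x => (x ∈ E ⊓ LinearMap.ker (ω b)) ∧ x ≠ 0)).card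
  rw [hcardU]
  apply Nat.sub_le_sub_right
  exact Nat.pow_le_pow_right (by norm_num) (hrb b hb.1)

end Abstract

end Tani
namespace Tani

section FrobeniusSystem

open Module

/-- The powers of a generator of the Galois group, indexed by `ZMod m`. -/
structure FrobSys (K : Type*) [Field K] (m : ℕ) where
  e : ZMod m → K →+* K
  e_zero : ∀ x, e 0 x = x
  e_add : ∀ i j x, e (i + j) x = e i (e j x)
  e_inj : Function.Injective e
  e_fix : ∀ t, e 1 t = t → t = 0 ∨ t = 1

variable {K : Type*} [Field K] {m : ℕ} [NeZero m] (Φ : FrobSys K m)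

lemma FrobSys.indep (c : ZMod m → K) (h : ∀ x, ∑ i, c i * Φ.e i x = 0) : c = 0 := by
  have hli := (linearIndependent_monoidHom K K).comp (fun i => (Φ.e i : K →* K))
    (fun i j hij => Φ.e_inj (by
      ext x
      exact DFunLike.congr_fun hij x))
  rw [Fintype.linearIndependent_iff] at hli
  funext i
  apply hli c
  funext x
  simpa [Finset.sum_apply] using h x

/-- The bilinear expression attached to a coefficient matrix. -/
def FrobSys.bil (M : ZMod m → ZMod m → K) (x u : K) : K :=
  ∑ i, ∑ j, M i j * (Φ.e i x * Φ.e j u)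

lemma FrobSys.bil_add (M M' : ZMod m → ZMod m → K) (x u : K) :
    Φ.bil M x u + Φ.bil M' x u = Φ.bil (fun i j => M i j + M' i j) x u := by
  simp only [FrobSys.bil, ← Finset.sum_add_distrib, add_mul]

lemma FrobSys.bil_ext (M M' : ZMod m → ZMod m → K) (h : ∀ x u, Φ.bil M x u = Φ.bil M' x u)
    (i j : ZMod m) : M i j = M' i j := by
  rw [← sub_eq_zero]
  have h1 : ∀ u, (fun i => ∑ j, (M i j - M' i j) * Φ.e j u) = 0 := by
    intro u
    apply Φ.indep
    intro x
    have := sub_eq_zero.mpr (h x u)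
    rw [← this]
    simp only [FrobSys.bil, ← Finset.sum_sub_distrib, Finset.sum_mul]
    refine Finset.sum_congr rfl fun i _ => Finset.sum_congr rfl fun j _ => ?_
    ring
  have h2 : (fun j => M i j - M' i j) = 0 := by
    apply Φ.indep
    intro u
    exact congrFun (h1 u) i
  exact congrFun h2 j

lemma FrobSys.bil_mul (a c : ZMod m → K) (x u : K) :
    (∑ i, a i * Φ.e i x) * (∑ j, c j * Φ.e j u) = Φ.bil (fun i j => a i * c j) x u := by
  rw [Finset.sum_mul_sum, FrobSys.bil]
  refine Finset.sum_congr rfl fun i _ => Finset.sum_congr rfl fun j _ => ?_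
  ring

lemma FrobSys.bil_diag (n : ZMod m → K) (s t : ZMod m) (x u : K) :
    ∑ i, n i * (Φ.e (i + s) x * Φ.e (i + t) u) =
      Φ.bil (fun i j => if j = i - s + t then n (i - s) else 0) x u := by
  rw [FrobSys.bil, ← Equiv.sum_comp (Equiv.subRight s)]
  refine Finset.sum_congr rfl fun i _ => ?_
  simp

lemma FrobSys.bil_single (p : K) (i j : ZMod m) (x u : K) :
    p * (Φ.e i x * Φ.e j u) =
      Φ.bil (fun i' j' => if i' = i ∧ j' = j then p else 0) x u := by
  rw [FrobSys.bil, Finset.sum_eq_single i, Finset.sum_eq_single j]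
  · simp
  · intro b _ hb; simp [hb]
  · simp
  · intro b _ hb; simp [hb]
  · simp

lemma FrobSys.spanning [Algebra (ZMod 2) K] [Finite K] (hd : finrank (ZMod 2) K = m)
    (L : K →ₗ[ZMod 2] K) : ∃ c : ZMod m → K, ∀ x, L x = ∑ i, c i * Φ.e i x := by
  let T : (ZMod m → K) → (K →ₗ[ZMod 2] K) := fun c =>
    AddMonoidHom.toZModLinearMap 2
      { toFun := fun x => ∑ i, c i * Φ.e i x
        map_zero' := by simp
        map_add' := fun x y => by simp [mul_add, Finset.sum_add_distrib] }
  have hT : ∀ c x, T c x = ∑ i, c i * Φ.e i x := fun c x => rfl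
  have hinj : Function.Injective T := by
    intro c c' h
    have : (fun i => c i - c' i) = 0 := by
      apply Φ.indep
      intro x
      have h1 : T c x = T c' x := by rw [h]
      rw [hT, hT] at h1
      simp only [sub_mul, Finset.sum_sub_distrib, h1, sub_self]
    funext i
    exact sub_eq_zero.mp (congrFun this i)
  have fin1 : Finite (K →ₗ[ZMod 2] K) := Module.finite_of_finite (ZMod 2)
  have hcard : Nat.card (ZMod m → K) = Nat.card (K →ₗ[ZMod 2] K) := by
    rw [card_sub (K →ₗ[ZMod 2] K), Module.finrank_linearMap, hd, Nat.card_fun, Nat.card_zmod,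
      card_sub K, hd, ← pow_mul]
  obtain ⟨c, hc⟩ := ((Nat.bijective_iff_injective_and_card T).mpr ⟨hinj, hcard⟩).2 L
  exact ⟨c, fun x => by rw [← hc, hT]⟩

end FrobeniusSystem

end Tani
namespace Tani

section TaniguchiForm

open Module

variable {K : Type*} [Field K] [Algebra (ZMod 2) K] {m : ℕ} (Φ : FrobSys K m) (α β : K)

/-- The Taniguchi function, written with the powers of the Frobenius generator. -/
def tf (p : K × K) : K × K :=
  (Φ.e 3 p.1 * Φ.e 2 p.1 + α * (Φ.e 2 p.1 * Φ.e 1 p.2) + β * (Φ.e 1 p.2 * p.2), p.1 * p.2)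

/-- Its polar form, as a plain function. -/
def tB0 (p q : K × K) : K × K :=
  (Φ.e 3 p.1 * Φ.e 2 q.1 + Φ.e 2 p.1 * Φ.e 3 q.1 +
    α * (Φ.e 2 p.1 * Φ.e 1 q.2 + Φ.e 2 q.1 * Φ.e 1 p.2) +
    β * (Φ.e 1 p.2 * q.2 + p.2 * Φ.e 1 q.2), p.1 * q.2 + q.1 * p.2)

/-- Its polar form. -/
def tB : (K × K) →ₗ[ZMod 2] (K × K) →ₗ[ZMod 2] (K × K) :=
  LinearMap.mk₂ (ZMod 2) (tB0 Φ α β)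
    (fun p p' q => by
      ext <;> simp only [tB0, Prod.fst_add, Prod.snd_add, map_add] <;> ring)
    (fun c p q => by
      rcases zmod2_cases c with rfl | rfl
      · ext <;> simp [tB0]
      · simp)
    (fun p q q' => by
      ext <;> simp only [tB0, Prod.fst_add, Prod.snd_add, map_add] <;> ring)
    (fun c p q => by
      rcases zmod2_cases c with rfl | rfl
      · ext <;> simp [tB0]
      · simp)

lemma tB_apply (p q : K × K) : tB Φ α β p q = tB0 Φ α β p q := rfl

lemma tf_add (p q : K × K) : tf Φ α β (p + q) = tf Φ α β p + tf Φ α β q + tB Φ α β p q := by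
  rw [tB_apply]
  ext <;> simp only [tf, tB0, Prod.fst_add, Prod.snd_add, map_add] <;> ring

lemma tB_apn (hroot : ∀ z, Φ.e 1 z * z + α * z + β ≠ 0) (p : K × K) (hp : p ≠ 0) (q : K × K)
    (h : tB Φ α β p q = 0) : q = 0 ∨ q = p := by
  obtain ⟨x, y⟩ := p
  obtain ⟨u, v⟩ := q
  rw [tB_apply, tB0, Prod.ext_iff] at h
  obtain ⟨h1, h2⟩ := h
  simp only [Prod.fst_zero, Prod.snd_zero] at h1 h2
  obtain ⟨t, rfl, rfl⟩ : ∃ t, u = t * x ∧ v = t * y := by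
    by_cases hx : x = 0
    · subst hx
      have hy : y ≠ 0 := by
        rintro rfl; exact hp rfl
      refine ⟨v / y, ?_, ?_⟩
      · rw [zero_mul, zero_add] at h2
        rw [mul_zero]
        exact (mul_eq_zero.mp h2).resolve_right hy
      · field_simp
    · refine ⟨u / x, by field_simp, ?_⟩
      have h3 : x * v = u * y := eq_of_add_zero h2
      field_simp
      rw [mul_comm v x, h3]
  have key : Φ.e 1 t = t → (t * x, t * y) = (0 : K × K) ∨ (t * x, t * y) = (x, y) := by
    intro ht
    rcases Φ.e_fix t ht with rfl | rfl
    · left; ext <;> simp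
    · right; simp
  apply key
  set w := t + Φ.e 1 t with hw
  have e2 : ∀ z, Φ.e 2 z = Φ.e 1 (Φ.e 1 z) := fun z => by
    rw [← Φ.e_add]; norm_num
  have e3 : ∀ z, Φ.e 3 z = Φ.e 1 (Φ.e 1 (Φ.e 1 z)) := fun z => by
    rw [← Φ.e_add, ← Φ.e_add]; norm_num
  by_contra hne
  have hw0 : w ≠ 0 := fun h => hne (eq_of_add_zero h).symm
  have inj0 : ∀ z, z ≠ 0 → Φ.e 1 z ≠ 0 := fun z hz => (map_ne_zero _).mpr hz
  have h4 : Φ.e 3 x * Φ.e 2 x * Φ.e 1 (Φ.e 1 w) + α * (Φ.e 2 x * Φ.e 1 y * Φ.e 1 w) +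
      β * (Φ.e 1 y * y * w) = 0 := by
    rw [← h1, hw]
    simp only [map_mul, map_add, e2, e3]
    ring
  by_cases hy : y = 0
  · subst hy
    simp only [map_zero, mul_zero, zero_mul, add_zero, e2, e3] at h4
    have hx : x ≠ 0 := by
      rintro rfl; exact hp rfl
    exact mul_ne_zero (mul_ne_zero (inj0 _ (inj0 _ (inj0 _ hx))) (inj0 _ (inj0 _ hx)))
      (inj0 _ (inj0 _ hw0)) h4
  · apply hroot (Φ.e 2 x * Φ.e 1 w / (y * w))
    have hy1 := inj0 _ hy
    have hw1 := inj0 _ hw0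
    have e12 : Φ.e 1 (Φ.e 2 x) = Φ.e 3 x := by rw [e2, e3]
    have h5 : Φ.e 1 (Φ.e 2 x * Φ.e 1 w / (y * w)) =
        Φ.e 3 x * Φ.e 1 (Φ.e 1 w) / (Φ.e 1 y * Φ.e 1 w) := by
      rw [map_div₀, map_mul, map_mul, e12]
    rw [h5]
    have h6 : Φ.e 3 x * Φ.e 1 (Φ.e 1 w) / (Φ.e 1 y * Φ.e 1 w) * (Φ.e 2 x * Φ.e 1 w / (y * w)) +
        α * (Φ.e 2 x * Φ.e 1 w / (y * w)) + β =
        (Φ.e 3 x * Φ.e 2 x * Φ.e 1 (Φ.e 1 w) + α * (Φ.e 2 x * Φ.e 1 y * Φ.e 1 w) +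
      β * (Φ.e 1 y * y * w)) / (Φ.e 1 y * y * w) := by
      field_simp
    rw [h6, h4, zero_div]

variable [Finite K] [NeZero m]

lemma zmod_ne (hm : 4 ≤ m) : (1 : ZMod m) ≠ 0 ∧ (2 : ZMod m) ≠ 0 ∧ (3 : ZMod m) ≠ 0 := by
  have h : ∀ j : ℕ, 0 < j → j < m → ((j : ℕ) : ZMod m) ≠ 0 := by
    intro j h1 h2 h3
    rw [ZMod.natCast_eq_zero_iff] at h3
    exact absurd (Nat.le_of_dvd h1 h3) (by omega)
  exact ⟨by simpa using h 1 (by norm_num) (by omega), by simpa using h 2 (by norm_num) (by omega),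
    by simpa using h 3 (by norm_num) (by omega)⟩

/-- Linear maps `K → K` killing the polar form vanish. -/
lemma tB_span (hm : 4 ≤ m) (hd : finrank (ZMod 2) K = m) (N : (K × K) →ₗ[ZMod 2] K)
    (h : ∀ p q, N (tB Φ α β p q) = 0) : N = 0 := by
  obtain ⟨n, hn⟩ := Φ.spanning hd (N ∘ₗ LinearMap.inl (ZMod 2) K K)
  obtain ⟨z1, z2, z3⟩ := zmod_ne hm
  have h0 : ∀ i, n i = 0 := by
    intro i
    have h1 := Φ.bil_ext (fun i j => (if j = i - 3 + 2 then n (i - 3) else 0) +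
      (if j = i - 2 + 3 then n (i - 2) else 0)) (fun i j => 0) (by
        intro x u
        rw [← Φ.bil_add, ← Φ.bil_diag, ← Φ.bil_diag]
        have h2 := h (x, 0) (u, 0)
        have h3 : tB Φ α β (x, 0) (u, 0) = LinearMap.inl (ZMod 2) K K
            (Φ.e 3 x * Φ.e 2 u + Φ.e 2 x * Φ.e 3 u) := by
          rw [tB_apply]; ext <;> simp [tB0]
        rw [h3, ← LinearMap.comp_apply, hn] at h2
        simp only [FrobSys.bil, zero_mul, Finset.sum_const_zero]
        rw [← h2, ← Finset.sum_add_distrib]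
        refine Finset.sum_congr rfl fun i _ => ?_
        rw [map_add, map_mul, map_mul]
        simp only [← Φ.e_add]
        ring) (i + 3) (i + 2)
    simp only [add_sub_cancel_right, if_true] at h1
    rw [if_neg, add_zero] at h1
    · exact h1
    · intro h; apply z2; linear_combination -h
  ext x
  · simp only [LinearMap.comp_apply, LinearMap.zero_apply]
    have := hn x
    rw [LinearMap.comp_apply] at this
    rw [this]
    simp [h0]
  · simp only [LinearMap.comp_apply, LinearMap.zero_apply]
    have h2 := h (1, 0) (0, x)
    have h3 : tB Φ α β (1, 0) (0, x) = LinearMap.inl (ZMod 2) K K (α * Φ.e 1 x) +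
        LinearMap.inr (ZMod 2) K K x := by
      rw [tB_apply]; ext <;> simp [tB0]
    rw [h3, map_add, ← LinearMap.comp_apply, hn] at h2
    simpa [h0] using h2

lemma tB_nz (hm : 4 ≤ m) (hd : finrank (ZMod 2) K = m) (c : Dual (ZMod 2) (K × K))
    (h : ∀ p q, c (tB Φ α β p q) = 0) : c = 0 := by
  have h1 := tB_span Φ α β hm hd ((Algebra.linearMap (ZMod 2) K) ∘ₗ c) (fun p q => by
    rw [LinearMap.comp_apply, h, map_zero])
  refine LinearMap.ext fun p => ?_
  have h2 := LinearMap.congr_fun h1 p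
  rw [LinearMap.comp_apply, LinearMap.zero_apply, Algebra.linearMap_apply] at h2
  rw [LinearMap.zero_apply]
  exact (algebraMap (ZMod 2) K).injective (by rw [h2, map_zero])

/-- Linear automorphisms of the graph are of extended linear type. -/
lemma t_ccz (hm : 4 ≤ m) (hd : finrank (ZMod 2) K = m)
    (hroot : ∀ z, Φ.e 1 z * z + α * z + β ≠ 0)
    (A1 A2 A3 A4 : (K × K) →ₗ[ZMod 2] (K × K))
    (hinj : Function.Injective (fun x => A1 x + A2 (tf Φ α β x)))
    (hgr : ∀ x, tf Φ α β (A1 x + A2 (tf Φ α β x)) = A3 x + A4 (tf Φ α β x))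
    (hsurj : ∀ v, ∃ x y, A1 x + A2 y = v) : A2 = 0 := by
  have fin : FiniteDimensional (ZMod 2) K := inferInstance
  have hsinj : Function.Injective (LinearMap.snd (ZMod 2) K K).dualMap := by
    intro a b hab
    ext x
    have := congrArg (fun t => t (0, x)) hab
    simpa using this
  refine ccz_is_el m ?_ (tf Φ α β) (tB Φ α β) (tf_add Φ α β) (tB_apn Φ α β hroot)
    (LinearMap.range (LinearMap.snd (ZMod 2) K K).dualMap) ?_ ?_ (tB_nz Φ α β hm hd)
    A1 A2 A3 A4 hinj hgr hsurj
  · rw [Module.finrank_prod, hd]; ring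
  · rw [LinearMap.finrank_range_of_inj hsinj, Subspace.dual_finrank_eq, hd]
  · rintro _ ⟨ℓ, rfl⟩ hc ⟨x, y⟩ h
    have hl : ℓ ≠ 0 := by
      rintro rfl; exact hc (map_zero _)
    simp only [LinearMap.dualMap_apply, LinearMap.snd_apply, tB_apply, tB0] at h
    by_contra hne
    apply hl
    ext z
    by_cases hx : x = 0
    · have hy : y ≠ 0 := by
        rintro rfl; exact hne (by rw [hx]; rfl)
      have := h (z / y, 0)
      simpa [hy] using this
    · have := h (0, z / x)
      rw [zero_mul, add_zero, mul_div_cancel₀ _ hx] at this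
      simpa using this

end TaniguchiForm

end Tani
namespace Tani

section Structure

open Module

variable {K : Type*} [Field K] [Algebra (ZMod 2) K] {m : ℕ} (Φ : FrobSys K m) (α β : K)
variable [Finite K] [NeZero m]

/-- Expansion of linear maps `K × K → K`. -/
lemma span2 (hd : finrank (ZMod 2) K = m) (T : (K × K) →ₗ[ZMod 2] K) :
    ∃ a b : ZMod m → K, ∀ x y, T (x, y) = ∑ i, a i * Φ.e i x + ∑ i, b i * Φ.e i y := by
  obtain ⟨a, ha⟩ := Φ.spanning hd (T ∘ₗ LinearMap.inl (ZMod 2) K K)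
  obtain ⟨b, hb⟩ := Φ.spanning hd (T ∘ₗ LinearMap.inr (ZMod 2) K K)
  refine ⟨a, b, fun x y => ?_⟩
  rw [← ha, ← hb]
  simp only [LinearMap.comp_apply, LinearMap.inl_apply, LinearMap.inr_apply, ← map_add]
  simp

/-- A matrix supported on one cyclic diagonal. -/
def dg (s t : ZMod m) (n : ZMod m → K) (i j : ZMod m) : K :=
  if j = i - s + t then n (i - s) else 0

lemma sum_e (n : ZMod m → K) (s t : ZMod m) (c x u : K) :
    ∑ i, n i * Φ.e i (c * (Φ.e s x * Φ.e t u)) =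
      Φ.bil (dg s t fun i => n i * Φ.e i c) x u := by
  unfold dg
  rw [← Φ.bil_diag (fun i => n i * Φ.e i c)]
  refine Finset.sum_congr rfl fun i _ => ?_
  simp only [map_mul, Φ.e_add]
  ring

lemma sum_e0 (n : ZMod m → K) (s t : ZMod m) (x u : K) :
    ∑ i, n i * Φ.e i (Φ.e s x * Φ.e t u) =
      Φ.bil (dg s t n) x u := by
  unfold dg
  rw [← Φ.bil_diag]
  refine Finset.sum_congr rfl fun i _ => ?_
  simp only [map_mul, Φ.e_add]

lemma sum_split (n : ZMod m → K) (z w : K) :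
    ∑ i, n i * Φ.e i (z + w) = ∑ i, n i * Φ.e i z + ∑ i, n i * Φ.e i w := by
  rw [← Finset.sum_add_distrib]
  refine Finset.sum_congr rfl fun i _ => ?_
  rw [map_add, mul_add]

/-- The coefficient equations of the second component. -/
lemma second_eqs (L : (K × K) →ₗ[ZMod 2] (K × K))
    (N2 : (K × K) →ₗ[ZMod 2] K)
    (h : ∀ p q, (tB Φ α β (L p) (L q)).2 = N2 (tB Φ α β p q))
    (a b c d n n' : ZMod m → K)
    (hL1 : ∀ x y, (L (x, y)).1 = ∑ i, a i * Φ.e i x + ∑ i, b i * Φ.e i y)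
    (hL2 : ∀ x y, (L (x, y)).2 = ∑ i, c i * Φ.e i x + ∑ i, d i * Φ.e i y)
    (hN : ∀ x y, N2 (x, y) = ∑ i, n i * Φ.e i x + ∑ i, n' i * Φ.e i y) (i j : ZMod m) :
    (a i * c j + c i * a j = dg 3 2 n i j +
      dg 2 3 n i j) ∧
    (a i * d j + c i * b j = dg 2 1 (fun i => n i * Φ.e i α) i j +
      dg 0 0 n' i j) ∧
    (b i * d j + d i * b j = dg 1 0 (fun i => n i * Φ.e i β) i j +
      dg 0 1 (fun i => n i * Φ.e i β) i j) := by
  refine ⟨?_, ?_, ?_⟩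
  · refine Φ.bil_ext (fun i j => a i * c j + c i * a j) (fun i j => dg 3 2 n i j + dg 2 3 n i j) ?_ i j
    intro x u
    have h1 := h (x, 0) (u, 0)
    rw [← Φ.bil_add, ← Φ.bil_add, ← Φ.bil_mul, ← Φ.bil_mul, ← sum_e0, ← sum_e0]
    have e1 : tB Φ α β (x, 0) (u, 0) = (Φ.e 3 x * Φ.e 2 u + Φ.e 2 x * Φ.e 3 u, 0) := by
      rw [tB_apply]; ext <;> simp [tB0]
    rw [e1, hN, sum_split, tB_apply, tB0] at h1
    simp only [hL1, hL2, map_zero, mul_zero, Finset.sum_const_zero, add_zero] at h1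
    rw [← h1]; ring
  · refine Φ.bil_ext (fun i j => a i * d j + c i * b j) (fun i j => dg 2 1 (fun i => n i * Φ.e i α) i j + dg 0 0 n' i j) ?_ i j
    intro x u
    have h1 := h (x, 0) (0, u)
    rw [← Φ.bil_add, ← Φ.bil_add, ← Φ.bil_mul, ← Φ.bil_mul, ← sum_e, ← sum_e0]
    have e1 : tB Φ α β (x, 0) (0, u) = (α * (Φ.e 2 x * Φ.e 1 u), Φ.e 0 x * Φ.e 0 u) := by
      rw [tB_apply]; ext <;> simp [tB0, Φ.e_zero]
    rw [e1, hN, tB_apply, tB0] at h1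
    simp only [hL1, hL2, map_zero, mul_zero, Finset.sum_const_zero, add_zero, zero_add] at h1
    rw [← h1]; ring
  · refine Φ.bil_ext (fun i j => b i * d j + d i * b j) (fun i j => dg 1 0 (fun i => n i * Φ.e i β) i j + dg 0 1 (fun i => n i * Φ.e i β) i j) ?_ i j
    intro x u
    have h1 := h (0, x) (0, u)
    rw [← Φ.bil_add, ← Φ.bil_add, ← Φ.bil_mul, ← Φ.bil_mul, ← sum_e, ← sum_e]
    have e1 : tB Φ α β (0, x) (0, u) = (β * (Φ.e 1 x * Φ.e 0 u) + β * (Φ.e 0 x * Φ.e 1 u), 0) := by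
      rw [tB_apply]; ext <;> simp [tB0, Φ.e_zero]; ring
    rw [e1, hN, sum_split, tB_apply, tB0] at h1
    simp only [hL1, hL2, map_zero, mul_zero, Finset.sum_const_zero, add_zero, zero_add] at h1
    rw [← h1]; ring

/-- The matrix of six entries occurring in the first component. -/
def six (i : ZMod m) (s1 s2 s3 s4 s5 s6 : K) (i' j' : ZMod m) : K :=
  (if i' = i + 3 ∧ j' = i + 2 then s1 else 0) + (if i' = i + 2 ∧ j' = i + 3 then s2 else 0) +
  (if i' = i + 2 ∧ j' = i + 1 then s3 else 0) + (if i' = i + 1 ∧ j' = i + 2 then s4 else 0) +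
  (if i' = i + 1 ∧ j' = i then s5 else 0) + (if i' = i ∧ j' = i + 1 then s6 else 0)

lemma bil_six (i : ZMod m) (s1 s2 s3 s4 s5 s6 x u : K) :
    Φ.bil (six i s1 s2 s3 s4 s5 s6) x u =
      s1 * (Φ.e (i + 3) x * Φ.e (i + 2) u) + s2 * (Φ.e (i + 2) x * Φ.e (i + 3) u) +
      s3 * (Φ.e (i + 2) x * Φ.e (i + 1) u) + s4 * (Φ.e (i + 1) x * Φ.e (i + 2) u) +
      s5 * (Φ.e (i + 1) x * Φ.e i u) + s6 * (Φ.e i x * Φ.e (i + 1) u) := by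
  simp only [Φ.bil_single, Φ.bil_add]
  rfl

/-- The coefficient equations of the first component. -/
lemma first_eqs (L : (K × K) →ₗ[ZMod 2] (K × K))
    (N1 : (K × K) →ₗ[ZMod 2] K)
    (h : ∀ p q, (tB Φ α β (L p) (L q)).1 = N1 (tB Φ α β p q))
    (i : ZMod m) (a b c d : K) (n n' : ZMod m → K)
    (hL1 : ∀ x y, (L (x, y)).1 = a * Φ.e i x + b * Φ.e i y)
    (hL2 : ∀ x y, (L (x, y)).2 = c * Φ.e i x + d * Φ.e i y)
    (hN : ∀ x y, N1 (x, y) = ∑ i, n i * Φ.e i x + ∑ i, n' i * Φ.e i y) (i' j : ZMod m) :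
    (six i (Φ.e 3 a * Φ.e 2 a) (Φ.e 3 a * Φ.e 2 a) (α * (Φ.e 2 a * Φ.e 1 c))
      (α * (Φ.e 2 a * Φ.e 1 c)) (β * (Φ.e 1 c * c)) (β * (Φ.e 1 c * c)) i' j =
      dg 3 2 n i' j +
      dg 2 3 n i' j) ∧
    (six i (Φ.e 3 a * Φ.e 2 b) (Φ.e 3 b * Φ.e 2 a) (α * (Φ.e 2 a * Φ.e 1 d))
      (α * (Φ.e 2 b * Φ.e 1 c)) (β * (Φ.e 1 c * d)) (β * (Φ.e 1 d * c)) i' j =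
      dg 2 1 (fun i => n i * Φ.e i α) i' j +
      dg 0 0 n' i' j) ∧
    (six i (Φ.e 3 b * Φ.e 2 b) (Φ.e 3 b * Φ.e 2 b) (α * (Φ.e 2 b * Φ.e 1 d))
      (α * (Φ.e 2 b * Φ.e 1 d)) (β * (Φ.e 1 d * d)) (β * (Φ.e 1 d * d)) i' j =
      dg 1 0 (fun i => n i * Φ.e i β) i' j +
      dg 0 1 (fun i => n i * Φ.e i β) i' j) := by
  refine ⟨?_, ?_, ?_⟩
  · refine Φ.bil_ext _ (fun i j => dg 3 2 n i j + dg 2 3 n i j) ?_ i' j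
    intro x u
    have h1 := h (x, 0) (u, 0)
    rw [bil_six, ← Φ.bil_add, ← sum_e0, ← sum_e0]
    have e1 : tB Φ α β (x, 0) (u, 0) = (Φ.e 3 x * Φ.e 2 u + Φ.e 2 x * Φ.e 3 u, 0) := by
      rw [tB_apply]; ext <;> simp [tB0]
    rw [e1, hN, sum_split, tB_apply, tB0] at h1
    simp only [hL1, hL2, map_zero, mul_zero, Finset.sum_const_zero, add_zero, map_mul,
      ← Φ.e_add] at h1
    simp only [map_mul, ← Φ.e_add, add_zero]
    rw [← h1, add_comm i 3, add_comm i 2, add_comm i 1]; ring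
  · refine Φ.bil_ext _ (fun i j => dg 2 1 (fun i => n i * Φ.e i α) i j + dg 0 0 n' i j) ?_ i' j
    intro x u
    have h1 := h (x, 0) (0, u)
    rw [bil_six, ← Φ.bil_add, ← sum_e, ← sum_e0]
    have e1 : tB Φ α β (x, 0) (0, u) = (α * (Φ.e 2 x * Φ.e 1 u), Φ.e 0 x * Φ.e 0 u) := by
      rw [tB_apply]; ext <;> simp [tB0, Φ.e_zero]
    rw [e1, hN, tB_apply, tB0] at h1
    simp only [hL1, hL2, map_zero, mul_zero, Finset.sum_const_zero, add_zero, zero_add, map_mul,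
      ← Φ.e_add] at h1
    simp only [map_mul, ← Φ.e_add, add_zero]
    rw [← h1, add_comm i 3, add_comm i 2, add_comm i 1]; ring
  · refine Φ.bil_ext _ (fun i j => dg 1 0 (fun i => n i * Φ.e i β) i j + dg 0 1 (fun i => n i * Φ.e i β) i j) ?_ i' j
    intro x u
    have h1 := h (0, x) (0, u)
    rw [bil_six, ← Φ.bil_add, ← sum_e, ← sum_e]
    have e1 : tB Φ α β (0, x) (0, u) = (β * (Φ.e 1 x * Φ.e 0 u) + β * (Φ.e 0 x * Φ.e 1 u), 0) := by
      rw [tB_apply]; ext <;> simp [tB0, Φ.e_zero]; ring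
    rw [e1, hN, sum_split, tB_apply, tB0] at h1
    simp only [hL1, hL2, map_zero, mul_zero, Finset.sum_const_zero, add_zero, zero_add, map_mul,
      ← Φ.e_add] at h1
    simp only [map_mul, ← Φ.e_add, add_zero]
    rw [← h1, add_comm i 3, add_comm i 2, add_comm i 1]; ring

end Structure

end Tani
namespace Tani

section Structure

open Module

variable {K : Type*} [Field K] [Algebra (ZMod 2) K] {m : ℕ} (Φ : FrobSys K m) (α β : K)
variable [Finite K] [NeZero m]

lemma two_zero (K : Type*) [Field K] [Algebra (ZMod 2) K] : (2 : K) = 0 := by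
  rw [← one_add_one_eq_two]; exact add_self_zero (1 : K)

lemma el_monomial (hm : 4 ≤ m) (hd : finrank (ZMod 2) K = m) (hβ : β ≠ 0)
    (L : (K × K) →ₗ[ZMod 2] (K × K)) (N2 : (K × K) →ₗ[ZMod 2] K) (hN2 : N2 ≠ 0)
    (h : ∀ p q, (tB Φ α β (L p) (L q)).2 = N2 (tB Φ α β p q)) :
    ∃ (i : ZMod m) (a b c d : K), a * d + c * b ≠ 0 ∧
      (∀ x y, (L (x, y)).1 = a * Φ.e i x + b * Φ.e i y) ∧
      (∀ x y, (L (x, y)).2 = c * Φ.e i x + d * Φ.e i y) := by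
  obtain ⟨a, b, hL1⟩ := span2 Φ hd (LinearMap.fst (ZMod 2) K K ∘ₗ L)
  obtain ⟨c, d, hL2⟩ := span2 Φ hd (LinearMap.snd (ZMod 2) K K ∘ₗ L)
  obtain ⟨n, n', hN⟩ := span2 Φ hd N2
  have key := second_eqs Φ α β L N2 h a b c d n n' hL1 hL2 hN
  have t2 := two_zero K
  obtain ⟨z1, z2, z3⟩ := zmod_ne hm
  have hn : ∀ i, n i = 0 := by
    intro i
    by_contra hni
    have k1 := (key (i + 3) (i + 2)).1
    have k2 := (key (i + 3) i).2.1
    have k3 := (key (i + 2) i).2.1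
    have k4 := (key (i + 1) i).2.2
    simp only [dg] at k1 k2 k3 k4
    rw [if_pos (by ring), if_neg (by intro h; apply z2; linear_combination -h)] at k1
    rw [if_neg (by intro h; apply z2; linear_combination -h),
      if_neg (by intro h; apply z3; linear_combination -h)] at k2
    rw [if_neg (by intro h; apply z1; linear_combination -h),
      if_neg (by intro h; apply z2; linear_combination -h)] at k3
    rw [if_pos (by ring), if_neg (by intro h; apply z2; linear_combination -h)] at k4
    simp only [add_sub_cancel_right, add_zero] at k1 k2 k3 k4
    have hd0 : n i * d i = 0 := by
      rw [← k1]
      linear_combination c (i + 2) * k2 + c (i + 3) * k3 - b i * c (i + 2) * c (i + 3) * t2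
    have hb0 : n i * b i = 0 := by
      rw [← k1]
      linear_combination a (i + 2) * k2 + a (i + 3) * k3 - d i * a (i + 2) * a (i + 3) * t2
    have hd1 := (mul_eq_zero.mp hd0).resolve_left hni
    have hb1 := (mul_eq_zero.mp hb0).resolve_left hni
    rw [hd1, hb1, mul_zero, mul_zero, add_zero] at k4
    exact mul_ne_zero hni ((map_ne_zero _).mpr hβ) k4.symm
  obtain ⟨i, hi⟩ : ∃ i, n' i ≠ 0 := by
    by_contra hcon
    push Not at hcon
    apply hN2
    refine LinearMap.ext fun p => ?_
    have := hN p.1 p.2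
    simpa [hn, hcon] using this
  have xx : ∀ i j, a i * c j + c i * a j = 0 := by
    intro i j; rw [(key i j).1]; simp [dg, hn]
  have yy : ∀ i j, b i * d j + d i * b j = 0 := by
    intro i j; rw [(key i j).2.2]; simp [dg, hn]
  have xy : ∀ i j, a i * d j + c i * b j = if j = i then n' i else 0 := by
    intro i j; rw [(key i j).2.1]; simp [dg, hn]
  have hdet : a i * d i + c i * b i ≠ 0 := by rw [xy, if_pos rfl]; exact hi
  have hz : ∀ j, j ≠ i → a j = 0 ∧ b j = 0 ∧ c j = 0 ∧ d j = 0 := by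
    intro j hj
    have k1 := xx i j
    have k2 := yy i j
    have k3 := xy i j
    have k4 := xy j i
    rw [if_neg hj] at k3
    rw [if_neg hj.symm] at k4
    refine ⟨?_, ?_, ?_, ?_⟩
    all_goals refine (mul_eq_zero.mp ?_).resolve_left hdet
    · linear_combination a i * k4 + b i * k1 - a i * b i * c j * t2
    · linear_combination a i * k2 + b i * k3 - a i * b i * d j * t2
    · linear_combination c i * k4 + d i * k1 - c i * a j * d i * t2
    · linear_combination c i * k2 + d i * k3 - b j * c i * d i * t2
  have hs : ∀ (g : ZMod m → K), (∀ j, j ≠ i → g j = 0) → ∀ x,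
      ∑ j, g j * Φ.e j x = g i * Φ.e i x := by
    intro g hg x
    refine Finset.sum_eq_single i (fun j _ hj => by rw [hg j hj, zero_mul]) (by simp)
  refine ⟨i, a i, b i, c i, d i, hdet, fun x y => ?_, fun x y => ?_⟩
  · have := hL1 x y
    rw [hs a (fun j hj => (hz j hj).1), hs b (fun j hj => (hz j hj).2.1)] at this
    exact this
  · have := hL2 x y
    rw [hs c (fun j hj => (hz j hj).2.2.1), hs d (fun j hj => (hz j hj).2.2.2)] at this
    exact this

lemma dg_pos (s t : ZMod m) (n : ZMod m → K) (i j k : ZMod m) (h : j = k + t) (hk : i = k + s) :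
    dg s t n i j = n k := by
  subst hk; subst h; simp [dg]

lemma dg_neg (s t : ZMod m) (n : ZMod m → K) (i j r : ZMod m) (hr : r ≠ 0) (h : j - i - t + s = r) :
    dg s t n i j = 0 := by
  rw [dg, if_neg]
  rintro rfl
  apply hr
  rw [← h]
  ring

/-- Parameters of the first kind. -/
def C1 (i : ZMod m) (a d : K) : Prop :=
  a ≠ 0 ∧ d ≠ 0 ∧ Φ.e 3 a * Φ.e 2 a * Φ.e i β = β * (Φ.e 1 d * d) ∧
    Φ.e 3 a * Φ.e i α = α * Φ.e 1 d

/-- Parameters of the second kind. -/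
def C2 (i : ZMod m) (b c : K) : Prop :=
  α = 0 ∧ m = 4 ∧ b ≠ 0 ∧ c ≠ 0 ∧ β * (Φ.e 1 c * c) * Φ.e (i + 2) β = Φ.e 3 b * Φ.e 2 b

lemma el_structure (hm : 4 ≤ m) (hd : finrank (ZMod 2) K = m) (hβ : β ≠ 0)
    (L : (K × K) →ₗ[ZMod 2] (K × K)) (N : (K × K) →ₗ[ZMod 2] (K × K))
    (hN : Function.Surjective N)
    (h : ∀ p q, tB Φ α β (L p) (L q) = N (tB Φ α β p q)) :
    (∃ i a d, C1 Φ α β i a d ∧ ∀ x y, L (x, y) = (a * Φ.e i x, d * Φ.e i y)) ∨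
    (∃ i b c, C2 Φ α β i b c ∧ ∀ x y, L (x, y) = (b * Φ.e i y, c * Φ.e i x)) := by
  have hN2 : LinearMap.snd (ZMod 2) K K ∘ₗ N ≠ 0 := by
    intro h0
    obtain ⟨p, hp⟩ := hN (0, 1)
    have := LinearMap.congr_fun h0 p
    simp [hp] at this
  obtain ⟨i, a, b, c, d, hdet, hL1, hL2⟩ := el_monomial Φ α β hm hd hβ L _ hN2
    (fun p q => by rw [h]; rfl)
  obtain ⟨n, n', hN'⟩ := span2 Φ hd (LinearMap.fst (ZMod 2) K K ∘ₗ N)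
  have key := first_eqs Φ α β L (LinearMap.fst (ZMod 2) K K ∘ₗ N) (fun p q => by rw [h]; rfl)
    i a b c d n n' hL1 hL2 hN'
  obtain ⟨z1, z2, z3⟩ := zmod_ne hm
  have nz : ∀ (j : ZMod m) {t : K}, t ≠ 0 → Φ.e j t ≠ 0 := fun j t ht => (map_ne_zero _).mpr ht
  have q1 := (key (i + 2) (i + 3)).2.1
  have q2 := (key (i + 1) (i + 2)).2.1
  have q3 := (key i (i + 1)).2.1
  have q4 := (key (i + 2) (i + 1)).2.1
  have q5 := (key (i + 3) (i + 2)).2.2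
  have q6 := (key (i + 1) i).2.2
  have q7 := (key (i + 3) (i + 2)).1
  have q8 := (key (i + 1) i).1
  have q9 := (key (i + 5) (i + 4)).1
  clear key
  have z10 : (1 : ZMod m) ≠ 2 := fun h => z1 (by linear_combination -h)
  have z11 : (1 : ZMod m) ≠ 3 := fun h => z2 (by linear_combination -h)
  have z12 : (2 : ZMod m) ≠ 3 := fun h => z1 (by linear_combination -h)
  have y1 : (-1 : ZMod m) ≠ 0 := neg_ne_zero.mpr z1
  have y2 : (-2 : ZMod m) ≠ 0 := neg_ne_zero.mpr z2
  rw [dg_neg 2 1 _ _ _ 2 z2 (by ring), dg_neg 0 0 _ _ _ 1 z1 (by ring)] at q1 q2 q3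
  rw [dg_pos 2 1 _ _ _ i rfl rfl, dg_neg 0 0 _ _ _ (-1) y1 (by ring)] at q4
  rw [dg_pos 1 0 _ _ _ (i + 2) (by ring) (by ring), dg_neg 0 1 _ _ _ (-2) y2 (by ring)] at q5
  rw [dg_pos 1 0 _ _ _ i (by ring) (by ring), dg_neg 0 1 _ _ _ (-2) y2 (by ring)] at q6
  rw [dg_pos 3 2 _ _ _ i (by ring) (by ring), dg_neg 2 3 _ _ _ (-2) y2 (by ring)] at q7
  rw [dg_pos 3 2 _ _ _ (i - 2) (by ring) (by ring), dg_neg 2 3 _ _ _ (-2) y2 (by ring)] at q8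
  rw [dg_pos 3 2 _ _ _ (i + 2) (by ring) (by ring), dg_neg 2 3 _ _ _ (-2) y2 (by ring)] at q9
  simp only [six, left_eq_add, add_eq_left, add_right_inj, z1, z2, z3, z10, z11, z12, z10.symm,
    z11.symm, z12.symm, if_true, if_false, and_true, true_and, false_and, and_false, add_zero,
    zero_add] at q1 q2 q3 q4 q5 q6 q7 q8
  have nz0 : ∀ (j : ZMod m) {t : K}, Φ.e j t = 0 → t = 0 := fun j t ht => (map_eq_zero _).mp ht
  have hba : b = 0 ∨ a = 0 := (mul_eq_zero.mp q1).imp (nz0 _) (nz0 _)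
  have hdc : d = 0 ∨ c = 0 :=
    (mul_eq_zero.mp ((mul_eq_zero.mp q3).resolve_left hβ)).imp (nz0 _) id
  rcases hba with rfl | rfl
  · have had : a * d ≠ 0 := by simpa using hdet
    obtain ⟨ha, hd'⟩ := mul_ne_zero_iff.mp had
    have hc := hdc.resolve_left hd'
    subst hc
    refine Or.inl ⟨i, a, d, ⟨ha, hd', ?_, ?_⟩, fun x y => ?_⟩
    · rw [q6, q7]
    · rw [← q7] at q4
      apply mul_left_cancel₀ (nz 2 ha)
      linear_combination -q4
    · ext
      · rw [hL1]; simp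
      · rw [hL2]; simp
  · have had : c * b ≠ 0 := by simpa using hdet
    obtain ⟨hc, hb⟩ := mul_ne_zero_iff.mp had
    have hd' := hdc.resolve_right hc
    subst hd'
    have hα : α = 0 := by
      rcases mul_eq_zero.mp q2 with h | h
      · exact h
      · exact absurd h (mul_ne_zero (nz _ hb) (nz _ hc))
    have h4 : (4 : ZMod m) = 0 := by
      by_contra h4
      have e1 : (5 : ZMod m) ≠ 3 := fun h => z2 (by linear_combination h)
      have e2 : (5 : ZMod m) ≠ 2 := fun h => z3 (by linear_combination h)
      have e3 : (5 : ZMod m) ≠ 1 := fun h => h4 (by linear_combination h)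
      have e4 : (4 : ZMod m) ≠ 1 := fun h => z3 (by linear_combination h)
      simp only [six, left_eq_add, add_eq_left, add_right_inj, e1, e2, e3, e4, false_and,
        and_false, if_false, add_zero] at q9
      rw [← q9, zero_mul] at q5
      exact mul_ne_zero (nz 3 hb) (nz 2 hb) q5
    have hm4 : m = 4 := by
      have h5 : ((4 : ℕ) : ZMod m) = 0 := by exact_mod_cast h4
      rw [ZMod.natCast_eq_zero_iff] at h5
      exact le_antisymm (Nat.le_of_dvd (by norm_num) h5) hm
    refine Or.inr ⟨i, b, c, ⟨hα, hm4, hb, hc, ?_⟩, fun x y => ?_⟩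
    · have h6 : i - 2 = i + 2 := by linear_combination -h4
      rw [q8, h6, q5]
    · ext
      · rw [hL1]; simp
      · rw [hL2]; simp

end Structure

end Tani
namespace Tani

section Structure

open Module

lemma isLin_of_add {V W : Type*} [AddCommGroup V] [Module (ZMod 2) V] [AddCommGroup W]
    [Module (ZMod 2) W] (g : V → W) (h : ∀ x y, g (x + y) = g x + g y) :
    IsLinearMap (ZMod 2) g := by
  refine ⟨h, fun c x => ?_⟩
  have h0 : g 0 = 0 := by simpa using h 0 0
  rcases zmod2_cases c with rfl | rfl
  · simp [h0]
  · simp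

lemma mem_autEL {V : Type*} [AddCommGroup V] [Module (ZMod 2) V] (f : V → V)
    (A : V × V → V × V) : A ∈ AutELSet f ↔ ∃ L M N : V →ₗ[ZMod 2] V,
      Function.Bijective L ∧ Function.Bijective N ∧ (∀ p, A p = (L p.1, M p.1 + N p.2)) ∧
      ∀ x, f (L x) = M x + N (f x) := by
  constructor
  · rintro ⟨⟨L, M, N, hL, hM, hN, bL, bN, hA⟩, hg⟩
    refine ⟨hL.mk' L, hM.mk' M, hN.mk' N, bL, bN, hA, fun x => ?_⟩
    have : A (x, f x) ∈ graphOf f := by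
      rw [← hg]; exact ⟨(x, f x), rfl, rfl⟩
    rw [hA] at this
    exact this.symm
  · rintro ⟨L, M, N, bL, bN, hA, hg⟩
    refine ⟨⟨L, M, N, L.isLinear, M.isLinear, N.isLinear, bL, bN, hA⟩, ?_⟩
    ext ⟨y, z⟩
    constructor
    · rintro ⟨⟨x, w⟩, hx, hxy⟩
      change w = f x at hx
      rw [hA] at hxy
      rw [← hxy]
      change M x + N w = f (L x)
      rw [hx, hg]
    · intro h
      change z = f y at h
      obtain ⟨x, rfl⟩ := bL.2 y
      refine ⟨(x, f x), rfl, ?_⟩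
      rw [hA, h, hg]

variable {K : Type*} [Field K] [Algebra (ZMod 2) K] {m : ℕ} (Φ : FrobSys K m) (α β : K)
variable [Finite K] [NeZero m]

/-- Automorphisms of the first kind. -/
def g1 (t : ZMod m × K × K) (p : (K × K) × (K × K)) : (K × K) × (K × K) :=
  ((t.2.1 * Φ.e t.1 p.1.1, t.2.2 * Φ.e t.1 p.1.2),
    (Φ.e 3 t.2.1 * Φ.e 2 t.2.1 * Φ.e t.1 p.2.1, t.2.1 * t.2.2 * Φ.e t.1 p.2.2))

/-- Automorphisms of the second kind. -/
def g2 (t : ZMod m × K × K) (p : (K × K) × (K × K)) : (K × K) × (K × K) :=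
  ((t.2.1 * Φ.e t.1 p.1.2, t.2.2 * Φ.e t.1 p.1.1),
    (β * (Φ.e 1 t.2.2 * t.2.2) * Φ.e (t.1 + 2) p.2.1, t.2.1 * t.2.2 * Φ.e t.1 p.2.2))

/-- The linear map `(x,y) ↦ (a e_i x, d e_j y)`. -/
def dl (i j : ZMod m) (a d : K) : (K × K) →ₗ[ZMod 2] (K × K) :=
  (isLin_of_add (fun p : K × K => (a * Φ.e i p.1, d * Φ.e j p.2)) (fun x y => by
    ext <;> simp [mul_add])).mk' _

lemma dl_bij (i j : ZMod m) (a d : K) (ha : a ≠ 0) (hd : d ≠ 0) :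
    Function.Bijective (dl Φ i j a d) := by
  refine Finite.injective_iff_bijective.mp ?_
  intro p q h
  have h' : (a * Φ.e i p.1, d * Φ.e j p.2) = (a * Φ.e i q.1, d * Φ.e j q.2) := h
  rw [Prod.mk.injEq] at h'
  ext
  · exact (Φ.e i).injective (mul_left_cancel₀ ha h'.1)
  · exact (Φ.e j).injective (mul_left_cancel₀ hd h'.2)

lemma g1_mem (hβ : β ≠ 0) (t : ZMod m × K × K) (ht : C1 Φ α β t.1 t.2.1 t.2.2) :
    ∃ L N : (K × K) →ₗ[ZMod 2] (K × K), Function.Bijective L ∧ Function.Bijective N ∧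
      (∀ p, g1 Φ t p = (L p.1, N p.2)) ∧ (∀ x y, L (x, y) = (t.2.1 * Φ.e t.1 x, t.2.2 * Φ.e t.1 y)) ∧
      ∀ x, tf Φ α β (L x) = N (tf Φ α β x) := by
  obtain ⟨i, a, d⟩ := t
  obtain ⟨ha, hd, h1, h2⟩ := ht
  simp only at ha hd h1 h2
  refine ⟨dl Φ i i a d, dl Φ i i (Φ.e 3 a * Φ.e 2 a) (a * d), dl_bij Φ _ _ _ _ ha hd,
    dl_bij Φ _ _ _ _ (mul_ne_zero ((map_ne_zero _).mpr ha) ((map_ne_zero _).mpr ha))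
      (mul_ne_zero ha hd), fun p => rfl, fun x y => rfl, fun x => ?_⟩
  obtain ⟨x, y⟩ := x
  change tf Φ α β (a * Φ.e i x, d * Φ.e i y) = (_ * Φ.e i (tf Φ α β (x, y)).1,
    _ * Φ.e i (tf Φ α β (x, y)).2)
  simp only [tf, map_add, map_mul, ← Φ.e_add, add_comm 3 i, add_comm 2 i, add_comm 1 i]
  ext
  · dsimp only
    linear_combination (-(Φ.e (i + 1) y * Φ.e i y)) * h1
      - (Φ.e 2 a * Φ.e (i + 2) x * Φ.e (i + 1) y) * h2
  · dsimp only; ring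

lemma g2_mem (hβ : β ≠ 0) (t : ZMod m × K × K) (ht : C2 Φ α β t.1 t.2.1 t.2.2) :
    ∃ L N : (K × K) →ₗ[ZMod 2] (K × K), Function.Bijective L ∧ Function.Bijective N ∧
      (∀ p, g2 Φ β t p = (L p.1, N p.2)) ∧ (∀ x y, L (x, y) = (t.2.1 * Φ.e t.1 y, t.2.2 * Φ.e t.1 x)) ∧
      ∀ x, tf Φ α β (L x) = N (tf Φ α β x) := by
  obtain ⟨i, b, c⟩ := t
  obtain ⟨rfl, rfl, hb, hc, h1⟩ := ht
  simp only at hb hc h1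
  refine ⟨dl Φ i i b c ∘ₗ (LinearEquiv.prodComm (ZMod 2) K K).toLinearMap,
    dl Φ (i + 2) i (β * (Φ.e 1 c * c)) (b * c), ?_,
    dl_bij Φ _ _ _ _ (mul_ne_zero hβ (mul_ne_zero ((map_ne_zero _).mpr hc) hc))
      (mul_ne_zero hb hc), fun p => rfl, fun x y => rfl, fun x => ?_⟩
  · rw [LinearMap.coe_comp]
    exact (dl_bij Φ _ _ _ _ hb hc).comp (LinearEquiv.prodComm (ZMod 2) K K).bijective
  obtain ⟨x, y⟩ := x
  change tf Φ 0 β (b * Φ.e i y, c * Φ.e i x) = (_ * Φ.e (i + 2) (tf Φ 0 β (x, y)).1,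
    _ * Φ.e i (tf Φ 0 β (x, y)).2)
  have e1 : i + 2 + 3 = i + 1 := by
    have : (4 : ZMod 4) = 0 := rfl
    linear_combination this
  have e2 : i + 2 + 2 = i := by
    have : (4 : ZMod 4) = 0 := rfl
    linear_combination this
  have e3 : i + 2 + 1 = i + 3 := by ring
  simp only [tf, map_add, map_mul, ← Φ.e_add, add_comm 3 i, add_comm 2 i, add_comm 1 i, e1, e2, e3]
  ext
  · simp only [zero_mul, map_zero, add_zero]
    linear_combination (-(Φ.e (i + 3) y * Φ.e (i + 2) y)) * h1
  · dsimp only; ring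

lemma polar_of (L M N : (K × K) →ₗ[ZMod 2] (K × K))
    (h : ∀ x, tf Φ α β (L x) = M x + N (tf Φ α β x)) (p q : K × K) :
    tB Φ α β (L p) (L q) = N (tB Φ α β p q) := by
  have h1 := h (p + q)
  rw [map_add, tf_add, tf_add, h, h, map_add, map_add, map_add] at h1
  have h2 : M p + N (tf Φ α β p) + (M q + N (tf Φ α β q)) + tB Φ α β (L p) (L q) =
    M p + N (tf Φ α β p) + (M q + N (tf Φ α β q)) + N (tB Φ α β p q) := by
    rw [h1]; abel
  exact add_left_cancel h2

lemma el_unique (hm : 4 ≤ m) (hd : finrank (ZMod 2) K = m)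
    (L M N M' N' : (K × K) →ₗ[ZMod 2] (K × K))
    (h : ∀ x, tf Φ α β (L x) = M x + N (tf Φ α β x))
    (h' : ∀ x, tf Φ α β (L x) = M' x + N' (tf Φ α β x)) : M = M' ∧ N = N' := by
  have e : ∀ p q, (N - N') (tB Φ α β p q) = 0 := by
    intro p q
    rw [LinearMap.sub_apply, ← polar_of Φ α β L M N h, ← polar_of Φ α β L M' N' h', sub_self]
  have e1 := tB_span Φ α β hm hd (LinearMap.fst (ZMod 2) K K ∘ₗ (N - N')) (fun p q => by
    rw [LinearMap.comp_apply, e, map_zero])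
  have e2 := tB_span Φ α β hm hd (LinearMap.snd (ZMod 2) K K ∘ₗ (N - N')) (fun p q => by
    rw [LinearMap.comp_apply, e, map_zero])
  have hN : N = N' := by
    rw [← sub_eq_zero]
    refine LinearMap.ext fun p => Prod.ext ?_ ?_
    · exact LinearMap.congr_fun e1 p
    · exact LinearMap.congr_fun e2 p
  refine ⟨LinearMap.ext fun x => ?_, hN⟩
  have := (h x).symm.trans (h' x)
  rw [hN] at this
  exact add_right_cancel this

/-- The extended linear automorphism group is parametrised explicitly. -/
theorem autEL_eq (hm : 4 ≤ m) (hd : finrank (ZMod 2) K = m) (hβ : β ≠ 0) :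
    AutELSet (tf Φ α β) = g1 Φ '' {t | C1 Φ α β t.1 t.2.1 t.2.2} ∪
      g2 Φ β '' {t | C2 Φ α β t.1 t.2.1 t.2.2} := by
  ext A
  constructor
  · intro hA
    obtain ⟨L, M, N, bL, bN, hA, hg⟩ := (mem_autEL _ _).mp hA
    rcases el_structure Φ α β hm hd hβ L N bN.2 (polar_of Φ α β L M N hg) with
      ⟨i, a, d, hC, hL⟩ | ⟨i, b, c, hC, hL⟩
    · left
      refine ⟨(i, a, d), hC, ?_⟩
      obtain ⟨L', N', -, -, hA', hL', hg'⟩ := g1_mem Φ α β hβ (i, a, d) hC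
      have hLL : L' = L := LinearMap.ext fun p => by
        obtain ⟨x, y⟩ := p
        rw [hL, hL']
      rw [hLL] at hA' hg'
      obtain ⟨hM, hN⟩ := el_unique Φ α β hm hd L M N 0 N' hg (by simpa using hg')
      funext p
      rw [hA, hA', hM, hN]; simp
    · right
      refine ⟨(i, b, c), hC, ?_⟩
      obtain ⟨L', N', -, -, hA', hL', hg'⟩ := g2_mem Φ α β hβ (i, b, c) hC
      have hLL : L' = L := LinearMap.ext fun p => by
        obtain ⟨x, y⟩ := p
        rw [hL, hL']
      rw [hLL] at hA' hg'
      obtain ⟨hM, hN⟩ := el_unique Φ α β hm hd L M N 0 N' hg (by simpa using hg')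
      funext p
      rw [hA, hA', hM, hN]; simp
  · rintro (⟨t, ht, rfl⟩ | ⟨t, ht, rfl⟩)
    · obtain ⟨L', N', b1, b2, hA', hL', hg'⟩ := g1_mem Φ α β hβ t ht
      exact (mem_autEL _ _).mpr ⟨L', 0, N', b1, b2, by simpa using hA', by simpa using hg'⟩
    · obtain ⟨L', N', b1, b2, hA', hL', hg'⟩ := g2_mem Φ α β hβ t ht
      exact (mem_autEL _ _).mpr ⟨L', 0, N', b1, b2, by simpa using hA', by simpa using hg'⟩

theorem autEL_ncard (hm : 4 ≤ m) (hd : finrank (ZMod 2) K = m) (hβ : β ≠ 0) :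
    (AutELSet (tf Φ α β)).ncard = {t : ZMod m × K × K | C1 Φ α β t.1 t.2.1 t.2.2}.ncard +
      {t : ZMod m × K × K | C2 Φ α β t.1 t.2.1 t.2.2}.ncard := by
  rw [autEL_eq Φ α β hm hd hβ, Set.ncard_union_eq, Set.ncard_image_of_injOn,
    Set.ncard_image_of_injOn]
  · rintro ⟨i, b, c⟩ h ⟨j, b', c'⟩ h' he
    obtain ⟨-, -, hb, hc, -⟩ := h
    have e1 := congrArg (fun t => t.1.1) (congrFun he ((0, 1), 0))
    have e2 := congrArg (fun t => t.1.2) (congrFun he ((1, 0), 0))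
    simp only [g2, map_one, mul_one] at e1 e2
    subst e1 e2
    have : i = j := by
      apply Φ.e_inj
      ext x
      have e3 := congrArg (fun t => t.1.1) (congrFun he ((0, x), 0))
      exact mul_left_cancel₀ hb e3
    rw [this]
  · rintro ⟨i, b, c⟩ h ⟨j, b', c'⟩ h' he
    obtain ⟨hb, hc, -⟩ := h
    have e1 := congrArg (fun t => t.1.1) (congrFun he ((1, 0), 0))
    have e2 := congrArg (fun t => t.1.2) (congrFun he ((0, 1), 0))
    simp only [g1, map_one, mul_one] at e1 e2
    subst e1 e2
    have : i = j := by
      apply Φ.e_inj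
      ext x
      have e3 := congrArg (fun t => t.1.1) (congrFun he ((x, 0), 0))
      exact mul_left_cancel₀ hb e3
    rw [this]
  · rw [Set.disjoint_left]
    rintro _ ⟨⟨i, a, d⟩, h, rfl⟩ ⟨⟨j, b, c⟩, h', he⟩
    have e1 := congrArg (fun t => t.1.1) (congrFun he ((1, 0), 0))
    simp only [g1, g2, map_one, mul_one, map_zero, mul_zero] at e1
    exact h.1 e1.symm

end Structure

end Tani
namespace Tani

section FullGroup

open Module

variable {K : Type*} [Field K] [Algebra (ZMod 2) K] {m : ℕ} (Φ : FrobSys K m) (α β : K)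

/-- The translation-type automorphisms. -/
def tau (a : K × K) (p : (K × K) × (K × K)) : (K × K) × (K × K) :=
  (p.1 + a, p.2 + tB Φ α β p.1 a + tf Φ α β a)

lemma tau_graph (a x : K × K) : tau Φ α β a (x, tf Φ α β x) = (x + a, tf Φ α β (x + a)) := by
  rw [tau, tf_add]
  ext1
  · rfl
  · dsimp only; abel

lemma tf_zero : tf Φ α β 0 = 0 := by
  simp [tf]

lemma tB_self (x : K × K) : tB Φ α β x x = 0 := by
  have := tf_add Φ α β x x
  rw [add_self_zero, add_self_zero, tf_zero, zero_add] at this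
  exact this.symm

lemma tau_tau (a : K × K) (p : (K × K) × (K × K)) :
    tau Φ α β a (tau Φ α β a p) = p := by
  simp only [tau]
  ext1
  · dsimp only
    rw [add_assoc, add_self_zero, add_zero]
  · dsimp only
    rw [map_add, LinearMap.add_apply, tB_self, add_zero]
    have : p.2 + tB Φ α β p.1 a + tf Φ α β a + tB Φ α β p.1 a + tf Φ α β a =
      p.2 + (tB Φ α β p.1 a + tB Φ α β p.1 a) + (tf Φ α β a + tf Φ α β a) := by abel
    rw [this, add_self_zero, add_self_zero, add_zero, add_zero]

variable [Finite K] [NeZero m]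

theorem aut_eq (hm : 4 ≤ m) (hd : finrank (ZMod 2) K = m)
    (hroot : ∀ z, Φ.e 1 z * z + α * z + β ≠ 0) :
    AutSet (tf Φ α β) = (fun t : (K × K) × ((K × K) × (K × K) → (K × K) × (K × K)) =>
      tau Φ α β t.1 ∘ t.2) '' (Set.univ ×ˢ AutELSet (tf Φ α β)) := by
  ext A
  constructor
  · rintro ⟨⟨Lin, hLin, bLin, c, hA⟩, hg⟩
    have h0 : A 0 ∈ graphOf (tf Φ α β) := by
      rw [← hg]
      exact ⟨0, (tf_zero Φ α β).symm, rfl⟩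
    have hL0 : Lin 0 = 0 := hLin.map_zero
    rw [hA, hL0, zero_add] at h0
    change c.2 = tf Φ α β c.1 at h0
    obtain ⟨a, b⟩ := c
    simp only at h0
    subst h0
    -- the linear part corrected by the translation
    have hB : ∀ p, tau Φ α β a (A p) = ((Lin p).1, (Lin p).2 + tB Φ α β (Lin p).1 a) := by
      intro p
      rw [hA, tau]
      ext1
      · dsimp only [Prod.fst_add]
        rw [add_assoc, add_self_zero, add_zero]
      · dsimp only [Prod.fst_add, Prod.snd_add]
        rw [map_add, LinearMap.add_apply, tB_self, add_zero]
        have : (Lin p).2 + tf Φ α β a + tB Φ α β (Lin p).1 a + tf Φ α β a =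
          (Lin p).2 + tB Φ α β (Lin p).1 a + (tf Φ α β a + tf Φ α β a) := by abel
        rw [this, add_self_zero, add_zero]
    set B : ((K × K) × (K × K)) →ₗ[ZMod 2] ((K × K) × (K × K)) :=
      (isLin_of_add (fun p => tau Φ α β a (A p)) (fun x y => by
        simp only [hB, hLin.map_add, Prod.fst_add, Prod.snd_add, map_add, LinearMap.add_apply]
        ext1
        · rfl
        · dsimp only [Prod.snd_add]; abel)).mk' _ with hBdef
    have hBA : ∀ p, B p = tau Φ α β a (A p) := fun p => rfl
    have Ainj : Function.Injective A := by
      intro p q h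
      rw [hA, hA] at h
      exact bLin.1 (add_right_cancel h)
    have Binj : Function.Injective B := by
      intro p q h
      apply Ainj
      rw [← tau_tau Φ α β a (A p), ← hBA, h, hBA, tau_tau]
    have Bbij : Function.Bijective B := Finite.injective_iff_bijective.mp Binj
    have Bgr : ∀ x, (B (x, tf Φ α β x)).2 = tf Φ α β (B (x, tf Φ α β x)).1 := by
      intro x
      have : A (x, tf Φ α β x) ∈ graphOf (tf Φ α β) := by
        rw [← hg]; exact ⟨(x, tf Φ α β x), rfl, rfl⟩
      have h2 : A (x, tf Φ α β x) = ((A (x, tf Φ α β x)).1, tf Φ α β (A (x, tf Φ α β x)).1) :=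
        Prod.ext rfl this
      rw [hBA, h2, tau_graph]
    let A1 := LinearMap.fst (ZMod 2) _ _ ∘ₗ B ∘ₗ LinearMap.inl (ZMod 2) (K × K) (K × K)
    let A2 := LinearMap.fst (ZMod 2) _ _ ∘ₗ B ∘ₗ LinearMap.inr (ZMod 2) (K × K) (K × K)
    let A3 := LinearMap.snd (ZMod 2) _ _ ∘ₗ B ∘ₗ LinearMap.inl (ZMod 2) (K × K) (K × K)
    let A4 := LinearMap.snd (ZMod 2) _ _ ∘ₗ B ∘ₗ LinearMap.inr (ZMod 2) (K × K) (K × K)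
    have hsplit : ∀ x y, B (x, y) = (A1 x + A2 y, A3 x + A4 y) := by
      intro x y
      have : (x, y) = LinearMap.inl (ZMod 2) (K × K) (K × K) x +
        LinearMap.inr (ZMod 2) (K × K) (K × K) y := by simp
      rw [this, map_add]
      rfl
    have hA2 : A2 = 0 := by
      refine t_ccz Φ α β hm hd hroot A1 A2 A3 A4 ?_ ?_ ?_
      · intro x y hxy
        simp only at hxy
        have h1 := Bgr x
        have h2 := Bgr y
        have : B (x, tf Φ α β x) = B (y, tf Φ α β y) := by
          refine Prod.ext ?_ ?_
          · rw [hsplit, hsplit]; exact hxy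
          · rw [h1, h2, hsplit, hsplit]
            dsimp only; rw [hxy]
        exact congrArg Prod.fst (Binj this)
      · intro x
        have h1 := Bgr x
        rw [hsplit] at h1
        exact h1.symm
      · intro v
        obtain ⟨⟨x, y⟩, hxy⟩ := Bbij.2 (v, 0)
        rw [hsplit] at hxy
        exact ⟨x, y, congrArg Prod.fst hxy⟩
    have bA1 : Function.Bijective A1 := by
      refine Finite.surjective_iff_bijective.mp ?_
      intro v
      obtain ⟨⟨x, y⟩, hxy⟩ := Bbij.2 (v, 0)
      rw [hsplit, hA2] at hxy
      exact ⟨x, by simpa using congrArg Prod.fst hxy⟩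
    have bA4 : Function.Bijective A4 := by
      refine Finite.injective_iff_bijective.mp ?_
      intro y y' h
      have : B (0, y) = B (0, y') := by
        rw [hsplit, hsplit, hA2, h]; simp
      exact congrArg Prod.snd (Binj this)
    refine ⟨(a, fun p => tau Φ α β a (A p)), ⟨trivial, ?_⟩, ?_⟩
    · refine (mem_autEL _ _).mpr ⟨A1, A3, A4, bA1, bA4, ?_, ?_⟩
      · intro p
        obtain ⟨x, y⟩ := p
        change tau Φ α β a (A (x, y)) = _
        rw [← hBA, hsplit, hA2]; simp
      · intro x
        have h1 := Bgr x
        rw [hsplit, hA2] at h1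
        simpa using h1.symm
    · funext p
      exact tau_tau Φ α β a (A p)
  · rintro ⟨⟨a, A⟩, ⟨-, hA⟩, rfl⟩
    obtain ⟨L, M, N, bL, bN, hA', hg⟩ := (mem_autEL _ _).mp hA
    simp only at hA'
    refine ⟨⟨fun p => ((A p).1, (A p).2 + tB Φ α β (A p).1 a), ?_, ?_, (a, tf Φ α β a), ?_⟩, ?_⟩
    · apply isLin_of_add
      intro x y
      simp only [hA', Prod.fst_add, Prod.snd_add, map_add, LinearMap.add_apply]
      ext1
      · rfl
      · dsimp only [Prod.snd_add]; abel
    · refine Finite.injective_iff_bijective.mp ?_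
      intro x y hxy
      simp only [hA', Prod.mk.injEq] at hxy
      obtain ⟨h1, h2⟩ := hxy
      have h3 := bL.1 h1
      rw [h3] at h2
      exact Prod.ext h3 (bN.1 (add_left_cancel (add_right_cancel h2)))
    · intro w
      change tau Φ α β a (A w) = _
      rw [tau]; rfl
    · ext ⟨y, z⟩
      constructor
      · rintro ⟨⟨x, w⟩, hx, hxy⟩
        change w = tf Φ α β x at hx
        rw [← hxy]
        change tau Φ α β a (A (x, w)) ∈ _
        have : A (x, w) = (L x, tf Φ α β (L x)) := by rw [hA', hg, hx]
        rw [this, tau_graph]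
        rfl
      · intro h
        change z = tf Φ α β y at h
        obtain ⟨x, hx⟩ := bL.2 (y + a)
        refine ⟨(x, tf Φ α β x), rfl, ?_⟩
        change tau Φ α β a (A (x, tf Φ α β x)) = _
        have : A (x, tf Φ α β x) = (L x, tf Φ α β (L x)) := by rw [hA', hg]
        rw [this, tau_graph, hx, h, add_assoc, add_self_zero, add_zero]

theorem aut_ncard (hm : 4 ≤ m) (hd : finrank (ZMod 2) K = m)
    (hroot : ∀ z, Φ.e 1 z * z + α * z + β ≠ 0) :
    (AutSet (tf Φ α β)).ncard = 2 ^ (2 * m) * (AutELSet (tf Φ α β)).ncard := by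
  rw [aut_eq Φ α β hm hd hroot, Set.InjOn.ncard_image, Set.ncard_prod, Set.ncard_univ,
    card_sub, Module.finrank_prod, hd, two_mul]
  rintro ⟨a, A⟩ ⟨-, hA⟩ ⟨a', A'⟩ ⟨-, hA'⟩ h
  obtain ⟨L, M, N, bL, bN, h1, hg⟩ := (mem_autEL _ _).mp hA
  obtain ⟨L', M', N', bL', bN', h1', hg'⟩ := (mem_autEL _ _).mp hA'
  simp only at hA hA' h1 h1'
  have e0 : A 0 = 0 := by rw [h1]; simp
  have e0' : A' 0 = 0 := by rw [h1']; simp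
  have e1 := congrArg Prod.fst (congrFun h 0)
  simp only [Function.comp_apply, e0, e0', tau, Prod.fst_zero, zero_add] at e1
  subst e1
  have : A = A' := by
    funext p
    have e2 := congrFun h p
    simp only [Function.comp_apply] at e2
    rw [← tau_tau Φ α β a (A p), e2, tau_tau]
  rw [this]

end FullGroup

end Tani
namespace Tani

section Concrete

open Module

lemma pw_period {K : Type*} [Field K] [Finite K] {m : ℕ} (hq : Nat.card K = 2 ^ m) (x : K)
    (n t : ℕ) : x ^ 2 ^ (n + m * t) = x ^ 2 ^ n := by
  have : Fintype K := Fintype.ofFinite K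
  have h1 : ∀ y : K, y ^ 2 ^ m = y := by
    intro y
    rw [← hq, Nat.card_eq_fintype_card, FiniteField.pow_card]
  induction t with
  | zero => simp
  | succ t ih =>
    rw [Nat.mul_succ, ← add_assoc, pow_add, pow_mul, h1, ih]

lemma pw_mod {K : Type*} [Field K] [Finite K] {m : ℕ} (hq : Nat.card K = 2 ^ m) (x : K)
    {a b : ℕ} (h : a % m = b % m) : x ^ 2 ^ a = x ^ 2 ^ b := by
  rw [← Nat.mod_add_div a m, ← Nat.mod_add_div b m, pw_period hq, pw_period hq, h]

lemma exists_gen (K : Type*) [Field K] [Finite K] : ∃ g : K, g ≠ 0 ∧ orderOf g = Nat.card K - 1 := by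
  have : Fintype K := Fintype.ofFinite K
  obtain ⟨g, hg⟩ := IsCyclic.exists_generator (α := Kˣ)
  refine ⟨g, g.ne_zero, ?_⟩
  rw [orderOf_units, orderOf_eq_card_of_forall_mem_zpowers hg, Nat.card_units]

lemma pw_order {K : Type*} [Field K] [Finite K] {m : ℕ} (hm : 0 < m) (hq : Nat.card K = 2 ^ m)
    (n : ℕ) (h : ∀ x : K, x ^ 2 ^ n = x) : m ∣ n := by
  have h1 : ∀ x : K, x ^ 2 ^ (n % m) = x := by
    intro x
    rw [← pw_mod hq x (a := n) (by simp)]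
    exact h x
  obtain ⟨g, hg0, hg⟩ := exists_gen K
  have h2 : g ^ (2 ^ (n % m) - 1) = 1 := by
    apply mul_right_cancel₀ hg0
    rw [one_mul, ← pow_succ, Nat.sub_add_cancel Nat.one_le_two_pow, h1]
  have h3 := orderOf_dvd_of_pow_eq_one h2
  rw [hg, hq] at h3
  have h4 : 2 ^ (n % m) < 2 ^ m := Nat.pow_lt_pow_right (by norm_num) (Nat.mod_lt _ hm)
  have h5 : 2 ^ (n % m) - 1 = 0 := by
    by_contra h6
    have := Nat.le_of_dvd (Nat.pos_of_ne_zero h6) h3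
    have : 0 < 2 ^ (n % m) := by positivity
    omega
  have h6 : 2 ^ (n % m) ≤ 1 := by omega
  rw [Nat.dvd_iff_mod_eq_zero]
  by_contra h7
  have := Nat.pow_lt_pow_right (a := 2) (by norm_num) (Nat.pos_of_ne_zero h7)
  omega

/-- The concrete system of Frobenius powers. -/
def frobSys {K : Type*} [Field K] [Finite K] [CharP K 2] {m k : ℕ} (hm : 4 ≤ m)
    (hq : Nat.card K = 2 ^ m) (hk : Nat.gcd k m = 1) : FrobSys K m :=
  have hadd : ∀ (i j : ZMod m) (x : K), iterateFrobenius K 2 (k * (i + j).val) x =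
      iterateFrobenius K 2 (k * i.val) (iterateFrobenius K 2 (k * j.val) x) := by
    intro i j x
    have : NeZero m := ⟨by omega⟩
    rw [iterateFrobenius_def, iterateFrobenius_def, iterateFrobenius_def, ← pow_mul, ← pow_add]
    apply pw_mod hq
    rw [ZMod.val_add, Nat.mul_mod, Nat.mod_mod, ← Nat.mul_mod, mul_add, add_comm]
  have hzero : ∀ x : K, iterateFrobenius K 2 (k * (0 : ZMod m).val) x = x := by
    intro x
    simp [iterateFrobenius_def]
  { e := fun i => iterateFrobenius K 2 (k * i.val)
    e_zero := hzero
    e_add := hadd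
    e_inj := by
      have : NeZero m := ⟨by omega⟩
      intro i j hij
      have h1 : ∀ x : K, x ^ 2 ^ (k * (i - j).val) = x := by
        intro x
        rw [← iterateFrobenius_def, sub_eq_add_neg, hadd]
        have h2 := RingHom.congr_fun hij (iterateFrobenius K 2 (k * (-j).val) x)
        simp only at h2
        rw [h2, ← hadd, add_neg_cancel, hzero]
      have h2 := pw_order (by omega) hq _ h1
      have h3 : m ∣ (i - j).val := (Nat.Coprime.symm hk).dvd_of_dvd_mul_left h2
      have h4 := Nat.eq_zero_of_dvd_of_lt h3 (ZMod.val_lt _)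
      rw [ZMod.val_eq_zero] at h4
      exact sub_eq_zero.mp h4
    e_fix := by
      intro t ht
      have : Fact (1 < m) := ⟨by omega⟩
      rw [iterateFrobenius_def, ZMod.val_one, mul_one] at ht
      have h1 : ∀ s : ℕ, t ^ 2 ^ (k * s) = t := by
        intro s
        induction s with
        | zero => simp
        | succ s ih => rw [Nat.mul_succ, pow_add, pow_mul, ih, ht]
      obtain ⟨s, -, hs⟩ := Nat.exists_mul_mod_eq_one_of_coprime (n := k) (k := m) hk (by omega)
      have h2 : t ^ 2 = t := by
        have h3 : t ^ 2 ^ 1 = t ^ 2 ^ (k * s) := by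
          apply pw_mod hq
          rw [hs, Nat.mod_eq_of_lt (by omega)]
        rw [h1, pow_one] at h3
        exact h3
      have h3 : t * (t - 1) = 0 := by linear_combination h2
      rcases mul_eq_zero.mp h3 with h | h
      · exact Or.inl h
      · exact Or.inr (sub_eq_zero.mp h) }

lemma frobSys_e {K : Type*} [Field K] [Finite K] [CharP K 2] {m k : ℕ} (hm : 4 ≤ m)
    (hq : Nat.card K = 2 ^ m) (hk : Nat.gcd k m = 1) (i : ZMod m) (x : K) :
    (frobSys hm hq hk).e i x = x ^ 2 ^ (k * i.val) := rfl

lemma frobSys_nat {K : Type*} [Field K] [Finite K] [CharP K 2] {m k : ℕ} (hm : 4 ≤ m)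
    (hq : Nat.card K = 2 ^ m) (hk : Nat.gcd k m = 1) (i : ℕ) (x : K) :
    (frobSys hm hq hk).e (i : ZMod m) x = x ^ 2 ^ (k * i) := by
  rw [frobSys_e, ZMod.val_natCast]
  apply pw_mod hq
  rw [Nat.mul_mod, Nat.mod_mod, ← Nat.mul_mod]

lemma taniguchi_eq {K : Type*} [Field K] [Finite K] [CharP K 2] {m k : ℕ} (hm : 4 ≤ m)
    (hq : Nat.card K = 2 ^ m) (hk : Nat.gcd k m = 1) (α β : K) :
    taniguchi k α β = tf (frobSys hm hq hk) α β := by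
  funext p
  have e1 := fun x : K => frobSys_nat hm hq hk 1 x
  have e2 := fun x : K => frobSys_nat hm hq hk 2 x
  have e3 := fun x : K => frobSys_nat hm hq hk 3 x
  push_cast at e1 e2 e3
  rw [taniguchi, tf, e1, e2, e3]
  ext
  · dsimp only
    have h : p.1 ^ (2 ^ (2 * k) * (2 ^ k + 1)) = p.1 ^ 2 ^ (k * 3) * p.1 ^ 2 ^ (k * 2) := by
      rw [← pow_add]
      congr 1
      ring
    rw [h, mul_one, pow_succ p.2, mul_comm 2 k, mul_assoc α]
  · rfl

end Concrete

end Tani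
namespace Tani

section Counting

lemma ncard_fib {I Z : Type*} [Finite I] [Finite Z] (p : I → Z → Prop) (T : Set I) (n : ℕ)
    (h1 : ∀ i ∈ T, {z | p i z}.ncard = n) (h2 : ∀ i ∉ T, {z | p i z}.ncard = 0) :
    {t : I × Z | p t.1 t.2}.ncard = n * T.ncard := by
  classical
  have := Fintype.ofFinite I
  have hs : {t : I × Z | p t.1 t.2}.ncard = ∑ i : I, {z | p i z}.ncard := by
    rw [← Nat.card_coe_set_eq]
    rw [Nat.card_congr (β := Σ i : I, {z | p i z})
      { toFun := fun t => ⟨t.1.1, ⟨t.1.2, t.2⟩⟩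
        invFun := fun s => ⟨(s.1, s.2.1), s.2.2⟩
        left_inv := fun t => rfl
        right_inv := fun s => rfl }]
    rw [Nat.card_sigma]
    simp only [Nat.card_coe_set_eq]
  rw [hs]
  have h3 : ∀ i : I, {z | p i z}.ncard = if i ∈ T then n else 0 := by
    intro i
    split_ifs with h
    · exact h1 i h
    · exact h2 i h
  simp only [h3]
  rw [← Finset.sum_filter, Finset.sum_const, smul_eq_mul, mul_comm]
  congr 1
  rw [← Set.ncard_coe_finset]
  congr 1
  ext i
  simp

lemma cnt {m : ℕ} [NeZero m] {u : ℕ} (hu : u ∣ m) :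
    u * {i : ZMod m | u ∣ i.val}.ncard = m := by
  obtain ⟨r, rfl⟩ := hu
  have hne : u * r ≠ 0 := NeZero.ne _
  have hu0 : 0 < u := Nat.pos_of_ne_zero (fun h => hne (by simp [h]))
  have h : {i : ZMod (u * r) | u ∣ i.val} =
      (fun s : ℕ => ((u * s : ℕ) : ZMod (u * r))) '' (Finset.range r : Set ℕ) := by
    ext i
    simp only [Set.mem_setOf_eq, Set.mem_image, Finset.coe_range, Set.mem_Iio]
    constructor
    · rintro ⟨s, hs⟩
      refine ⟨s, ?_, ?_⟩
      · have := ZMod.val_lt i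
        rw [hs] at this
        exact Nat.lt_of_mul_lt_mul_left this
      · rw [← hs, ZMod.natCast_zmod_val]
    · rintro ⟨s, hs, rfl⟩
      rw [ZMod.val_natCast, Nat.mod_eq_of_lt (Nat.mul_lt_mul_of_pos_left hs hu0)]
      exact dvd_mul_right _ _
  rw [h, Set.ncard_image_of_injOn, Set.ncard_coe_finset, Finset.card_range]
  intro s hs t ht hst
  simp only [Finset.coe_range, Set.mem_Iio] at hs ht
  have h1 := congrArg ZMod.val hst
  simp only at h1
  rw [ZMod.val_natCast, ZMod.val_natCast, Nat.mod_eq_of_lt (Nat.mul_lt_mul_of_pos_left hs hu0),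
    Nat.mod_eq_of_lt (Nat.mul_lt_mul_of_pos_left ht hu0)] at h1
  exact Nat.eq_of_mul_eq_mul_left hu0 h1

lemma nz_card (K : Type*) [Field K] [Finite K] : {a : K | a ≠ 0}.ncard = Nat.card K - 1 := by
  have h : {a : K | a ≠ 0} = ({0} : Set K)ᶜ := by ext; simp
  rw [h, Set.ncard_compl, Set.ncard_singleton]

/-- Two-level fibre count. -/
lemma ncard_fib2 {K : Type*} [Field K] [Finite K] {m : ℕ} [NeZero m]
    (p : ZMod m → K → K → Prop) (T : Set (ZMod m)) (n : ℕ)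
    (h0 : ∀ i d, ¬ p i 0 d)
    (h1 : ∀ i ∈ T, ∀ a, a ≠ 0 → {d | p i a d}.ncard = n)
    (h2 : ∀ i ∉ T, ∀ a d, ¬ p i a d) :
    {t : ZMod m × K × K | p t.1 t.2.1 t.2.2}.ncard = n * (Nat.card K - 1) * T.ncard := by
  apply ncard_fib (fun i (z : K × K) => p i z.1 z.2) T
  · intro i hi
    rw [ncard_fib (p i) {a : K | a ≠ 0} n (h1 i hi), nz_card]
    intro a ha
    simp only [Set.mem_setOf_eq, not_not] at ha
    subst ha
    simp [h0]
  · intro i hi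
    simp [h2 i hi]

lemma u0_spec {K : Type*} [Field K] [Finite K] {m k : ℕ} (hm : 4 ≤ m)
    (hq : Nat.card K = 2 ^ m) (hk : Nat.gcd k m = 1) (b : K) :
    sInf {u : ℕ | 0 < u ∧ b ^ 2 ^ u = b} ∣ m ∧
    ∀ n : ℕ, b ^ 2 ^ (k * n) = b ↔ sInf {u : ℕ | 0 < u ∧ b ^ 2 ^ u = b} ∣ n := by
  set u := sInf {u : ℕ | 0 < u ∧ b ^ 2 ^ u = b} with hu
  have hmm : b ^ 2 ^ m = b := by
    have := pw_mod hq b (a := m) (b := 0) (by simp)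
    simpa using this
  have hne : {u : ℕ | 0 < u ∧ b ^ 2 ^ u = b}.Nonempty := ⟨m, by omega, hmm⟩
  obtain ⟨hu0, hub⟩ : 0 < u ∧ b ^ 2 ^ u = b := Nat.sInf_mem hne
  have hmul : ∀ t r : ℕ, b ^ 2 ^ (u * t + r) = b ^ 2 ^ r := by
    intro t r
    induction t with
    | zero => simp
    | succ t ih =>
      rw [show u * (t + 1) + r = u + (u * t + r) by ring, pow_add, pow_mul, hub, ih]
  have hiff : ∀ n : ℕ, b ^ 2 ^ n = b ↔ u ∣ n := by
    intro n
    constructor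
    · intro h
      rw [← Nat.div_add_mod n u, hmul] at h
      rw [Nat.dvd_iff_mod_eq_zero]
      by_contra h0
      have := Nat.sInf_le (s := {u : ℕ | 0 < u ∧ b ^ 2 ^ u = b}) ⟨Nat.pos_of_ne_zero h0, h⟩
      have := Nat.mod_lt n hu0
      omega
    · rintro ⟨t, rfl⟩
      have := hmul t 0
      simpa using this
  have hum : u ∣ m := (hiff m).1 hmm
  refine ⟨hum, fun n => ?_⟩
  rw [hiff]
  have hc : Nat.Coprime u k := (Nat.Coprime.coprime_dvd_right hum hk).symm
  exact ⟨fun h => hc.dvd_of_dvd_mul_left h, fun h => Dvd.dvd.mul_left h k⟩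

end Counting

end Tani
namespace Tani

section CountA

variable {K : Type*} [Field K] [Finite K] {m : ℕ} [NeZero m] (Φ : FrobSys K m)

lemma C1_iff (α β s : K) (hβ : β ≠ 0) (hα : α ≠ 0) (hs : Φ.e 1 s = α) (i : ZMod m) (a d : K)
    (ha : a ≠ 0) :
    C1 Φ α β i a d ↔ (Φ.e i (β / (s * α)) = β / (s * α) ∧ d = Φ.e 2 a * Φ.e i s / s) := by
  have hs0 : s ≠ 0 := by
    rintro rfl
    exact hα (by rw [← hs, map_zero])
  have hei : Φ.e i α = Φ.e 1 (Φ.e i s) := by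
    rw [← hs, ← Φ.e_add, ← Φ.e_add, add_comm]
  have h3 : Φ.e 3 a = Φ.e 1 (Φ.e 2 a) := by
    rw [← Φ.e_add]; norm_num
  have n2 : Φ.e 2 a ≠ 0 := (map_ne_zero _).2 ha
  have n3 : Φ.e 3 a ≠ 0 := (map_ne_zero _).2 ha
  have nis : Φ.e i s ≠ 0 := (map_ne_zero _).2 hs0
  have nia : Φ.e i α ≠ 0 := (map_ne_zero _).2 hα
  have hd : (Φ.e 3 a * Φ.e i α = α * Φ.e 1 d) ↔ d = Φ.e 2 a * Φ.e i s / s := by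
    rw [hei, h3, ← hs, ← map_mul, ← map_mul, (Φ.e 1).injective.eq_iff, eq_div_iff hs0]
    constructor <;> intro h <;> linear_combination -h
  have hb : Φ.e i (β / (s * α)) = β / (s * α) ↔ Φ.e i β * (s * α) = β * (Φ.e i s * Φ.e i α) := by
    rw [map_div₀, map_mul, div_eq_div_iff (mul_ne_zero nis nia) (mul_ne_zero hs0 hα)]
  rw [C1, hd, hb]
  constructor
  · rintro ⟨-, -, h1, h2⟩
    refine ⟨?_, h2⟩
    have h4 := hd.2 h2
    have h5 : s * d = Φ.e 2 a * Φ.e i s := by rw [h2]; field_simp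
    apply mul_left_cancel₀ (mul_ne_zero n3 n2)
    linear_combination (s * α) * h1 + β * Φ.e 3 a * Φ.e i α * h5 - β * (s * d) * h4
  · rintro ⟨h1, h2⟩
    have h4 := hd.2 h2
    have h5 : s * d = Φ.e 2 a * Φ.e i s := by rw [h2]; field_simp
    refine ⟨ha, ?_, ?_, h2⟩
    · rw [h2]
      exact div_ne_zero (mul_ne_zero n2 nis) hs0
    · apply mul_left_cancel₀ (mul_ne_zero hs0 hα)
      linear_combination (Φ.e 3 a * Φ.e 2 a) * h1 - β * Φ.e 3 a * Φ.e i α * h5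
        + β * (s * d) * h4

lemma countA (α β s : K) (hβ : β ≠ 0) (hα : α ≠ 0) (hs : Φ.e 1 s = α) :
    {t : ZMod m × K × K | C1 Φ α β t.1 t.2.1 t.2.2}.ncard =
      (Nat.card K - 1) * {i : ZMod m | Φ.e i (β / (s * α)) = β / (s * α)}.ncard := by
  rw [ncard_fib2 (C1 Φ α β) {i : ZMod m | Φ.e i (β / (s * α)) = β / (s * α)} 1, one_mul]
  · intro i d h
    exact h.1 rfl
  · intro i hi a ha
    rw [Set.ncard_eq_one]
    refine ⟨Φ.e 2 a * Φ.e i s / s, ?_⟩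
    ext d
    simp only [Set.mem_setOf_eq] at hi
    simp only [Set.mem_setOf_eq, Set.mem_singleton_iff, C1_iff Φ α β s hβ hα hs i a d ha, hi,
      true_and]
  · intro i hi a d h
    exact hi ((C1_iff Φ α β s hβ hα hs i a d h.1).1 h).1

lemma countA2 (α β : K) (hα : α ≠ 0) :
    {t : ZMod m × K × K | C2 Φ α β t.1 t.2.1 t.2.2}.ncard = 0 := by
  have : {t : ZMod m × K × K | C2 Φ α β t.1 t.2.1 t.2.2} = ∅ := by
    ext t
    simp [C2, hα]
  rw [this, Set.ncard_empty]

end CountA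

end Tani
namespace Tani

section CountB

variable {K : Type*} [Field K] [Finite K]

lemma pow_Q (x : K) (hx : x ≠ 0) : x ^ (Nat.card K - 1) = 1 := by
  have : Fintype K := Fintype.ofFinite K
  rw [Nat.card_eq_fintype_card]
  exact FiniteField.pow_card_sub_one_eq_one x hx

lemma gen_pow {g : K} (hg0 : g ≠ 0) (hg : orderOf g = Nat.card K - 1) (w : K) (hw : w ≠ 0) :
    ∃ j : ℕ, g ^ j = w := by
  have : Fintype K := Fintype.ofFinite K
  have h1 : orderOf (Units.mk0 g hg0) = Nat.card Kˣ := by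
    rw [← orderOf_units, Units.val_mk0, hg, Nat.card_units]
  have h3 : Subgroup.zpowers (Units.mk0 g hg0) = ⊤ :=
    Subgroup.eq_top_of_card_eq _ (by rw [Nat.card_zpowers, h1])
  have h4 : Units.mk0 w hw ∈ Subgroup.zpowers (Units.mk0 g hg0) := by
    rw [h3]
    exact Subgroup.mem_top _
  have h2 := mem_powers_iff_mem_zpowers.2 h4
  obtain ⟨j, hj⟩ := h2
  refine ⟨j, ?_⟩
  have := congrArg Units.val hj
  simpa using this

lemma pow_range {N n : ℕ} (hn : Nat.gcd N (Nat.card K - 1) = n) (w : K) (hw : w ≠ 0)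
    (h : w ^ ((Nat.card K - 1) / n) = 1) : ∃ z : K, z ≠ 0 ∧ z ^ N = w := by
  obtain ⟨g, hg0, hg⟩ := exists_gen K
  obtain ⟨j, rfl⟩ := gen_pow hg0 hg w hw
  have hQ : 0 < Nat.card K - 1 := by
    have := Finite.one_lt_card (α := K)
    omega
  have hnQ : n ∣ Nat.card K - 1 := hn ▸ Nat.gcd_dvd_right _ _
  have hn0 : 0 < n := Nat.pos_of_dvd_of_pos hnQ hQ
  have hd : 0 < (Nat.card K - 1) / n := Nat.div_pos (Nat.le_of_dvd hQ hnQ) hn0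
  rw [← pow_mul] at h
  have h1 := orderOf_dvd_of_pow_eq_one h
  rw [hg] at h1
  have h2 : n ∣ j := by
    apply Nat.dvd_of_mul_dvd_mul_right hd
    rwa [Nat.mul_div_cancel' hnQ]
  obtain ⟨t, rfl⟩ := h2
  refine ⟨(g ^ t) ^ (Nat.gcdA N (Nat.card K - 1)), zpow_ne_zero _ (pow_ne_zero _ hg0), ?_⟩
  have h3 := Nat.gcd_eq_gcd_ab N (Nat.card K - 1)
  rw [hn] at h3
  have h4 : (g ^ t) ^ (Nat.card K - 1) = 1 := pow_Q _ (pow_ne_zero _ hg0)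
  have hgt : g ^ t ≠ 0 := pow_ne_zero _ hg0
  rw [mul_comm n t, pow_mul, ← zpow_natCast (g ^ t) n, h3, zpow_add₀ hgt, zpow_mul (g ^ t) (Nat.card K - 1 : ℕ),
    zpow_natCast, h4, one_zpow, mul_one, mul_comm, zpow_mul, zpow_natCast]

lemma exists_omega (h3 : 3 ∣ Nat.card K - 1) : ∃ ω : K, ω ≠ 1 ∧ ω ^ 3 = 1 := by
  obtain ⟨g, hg0, hg⟩ := exists_gen K
  have hQ : 0 < Nat.card K - 1 := by
    have := Finite.one_lt_card (α := K)
    omega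
  obtain ⟨r, hr⟩ := h3
  refine ⟨g ^ r, ?_, ?_⟩
  · intro h
    have := Nat.le_of_dvd (by omega) (orderOf_dvd_of_pow_eq_one h)
    omega
  · rw [← pow_mul, mul_comm, ← hr, ← hg, pow_orderOf_eq_one]

lemma cube_roots_card (h3 : 3 ∣ Nat.card K - 1) : {y : K | y ^ 3 = 1}.ncard = 3 := by
  obtain ⟨ω, h1, hω⟩ := exists_omega h3
  have hs : ω ^ 2 + ω + 1 = 0 := by
    have : (ω - 1) * (ω ^ 2 + ω + 1) = 0 := by linear_combination hω
    exact (mul_eq_zero.1 this).resolve_left (sub_ne_zero.2 h1)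
  have h0 : ω ≠ 0 := by rintro rfl; simp at hω
  rw [Set.ncard_eq_three]
  refine ⟨1, ω, ω ^ 2, h1.symm, ?_, ?_, ?_⟩
  · intro h
    apply h1
    linear_combination hω + ω * h
  · intro h
    apply h1
    apply mul_left_cancel₀ h0
    linear_combination -h
  · ext y
    simp only [Set.mem_setOf_eq, Set.mem_insert_iff, Set.mem_singleton_iff]
    constructor
    · intro h
      have : (y - 1) * ((y - ω) * (y - ω ^ 2)) = 0 := by
        linear_combination h + (y - y ^ 2) * hs + (y - 1) * hω
      rcases mul_eq_zero.1 this with h | h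
      · exact Or.inl (sub_eq_zero.1 h)
      · rcases mul_eq_zero.1 h with h | h
        · exact Or.inr (Or.inl (sub_eq_zero.1 h))
        · exact Or.inr (Or.inr (sub_eq_zero.1 h))
    · rintro (rfl | rfl | rfl)
      · simp
      · exact hω
      · rw [← pow_mul, mul_comm, pow_mul, hω, one_pow]

lemma pow_fib {N : ℕ} (hN : N ≠ 0) (hn : Nat.gcd N (Nat.card K - 1) = 3) (w : K) (hw : w ≠ 0)
    (h : w ^ ((Nat.card K - 1) / 3) = 1) : {d : K | d ^ N = w}.ncard = 3 := by
  obtain ⟨z, hz, rfl⟩ := pow_range hn w hw h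
  rw [← cube_roots_card (K := K) (hn ▸ Nat.gcd_dvd_right _ _)]
  have hset : {d : K | d ^ N = z ^ N} = (fun y => z * y) '' {y : K | y ^ 3 = 1} := by
    ext d
    simp only [Set.mem_setOf_eq, Set.mem_image]
    constructor
    · intro hd
      have hd0 : d ≠ 0 := by
        rintro rfl
        rw [zero_pow hN] at hd
        exact hw hd.symm
      refine ⟨d / z, ?_, by field_simp⟩
      rw [← hn]
      rw [pow_gcd_eq_one]
      constructor
      · rw [div_pow, hd, div_self hw]
      · exact pow_Q _ (div_ne_zero hd0 hz)
    · rintro ⟨y, hy, rfl⟩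
      obtain ⟨r, hr⟩ : 3 ∣ N := hn ▸ Nat.gcd_dvd_left _ _
      rw [mul_pow, hr, pow_mul y, hy, one_pow, mul_one]
  rw [hset, Set.ncard_image_of_injective _ (mul_right_injective₀ hz)]

lemma pow_nofib {N : ℕ} (hn : Nat.gcd N (Nat.card K - 1) = 3) (w d : K) (hd : d ≠ 0)
    (h : d ^ N = w) : w ^ ((Nat.card K - 1) / 3) = 1 := by
  obtain ⟨r, hr⟩ : 3 ∣ N := hn ▸ Nat.gcd_dvd_left _ _
  have h3 : 3 ∣ Nat.card K - 1 := hn ▸ Nat.gcd_dvd_right _ _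
  rw [← h, hr, ← pow_mul, show 3 * r * ((Nat.card K - 1) / 3) = (3 * ((Nat.card K - 1) / 3)) * r by ring,
    Nat.mul_div_cancel' h3, pow_mul, pow_Q d hd, one_pow]

lemma gcd_cases {m k : ℕ} (hk : Nat.gcd k m = 1) :
    (Nat.gcd (2 ^ k + 1) (2 ^ m - 1) = 1) ∨
    (Nat.gcd (2 ^ k + 1) (2 ^ m - 1) = 3 ∧ 2 ∣ m ∧ k % 2 = 1) := by
  have h1 : Nat.gcd (2 ^ k + 1) (2 ^ m - 1) ∣ 2 ^ Nat.gcd (2 * k) m - 1 := by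
    rw [← Nat.pow_sub_one_gcd_pow_sub_one]
    apply Nat.dvd_gcd
    · refine (Nat.gcd_dvd_left _ _).trans ⟨2 ^ k - 1, ?_⟩
      rw [← Nat.sq_sub_sq, ← pow_mul, mul_comm, one_pow]
    · exact Nat.gcd_dvd_right _ _
  have h2 : Nat.gcd (2 * k) m = Nat.gcd 2 m := Nat.Coprime.gcd_mul_right_cancel 2 hk
  rw [h2] at h1
  rcases Nat.even_or_odd m with hm | hm
  · have h2m : 2 ∣ m := hm.two_dvd
    have hk2 : k % 2 = 1 := by
      by_contra hc
      have : 2 ∣ Nat.gcd k m := Nat.dvd_gcd (by omega) h2m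
      rw [hk] at this
      omega
    right
    refine ⟨?_, h2m, hk2⟩
    rw [Nat.gcd_eq_left h2m] at h1
    apply Nat.dvd_antisymm h1
    apply Nat.dvd_gcd
    · have := Odd.nat_add_dvd_pow_add_pow 2 1 (n := k) (Nat.odd_iff.2 hk2)
      simpa using this
    · obtain ⟨r, rfl⟩ := h2m
      have := Nat.sub_dvd_pow_sub_pow (2 ^ 2) 1 r
      rw [← pow_mul, one_pow] at this
      exact this
  · left
    rw [Nat.Coprime.gcd_eq_one (Nat.coprime_two_left.2 hm)] at h1
    exact Nat.dvd_one.1 h1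

end CountB

end Tani
namespace Tani

section CountC

lemma four_count0 : {i : ZMod 4 | ¬ 2 ∣ (i + 2).val}.ncard = 2 := by
  rw [Set.ncard_eq_toFinset_card']
  decide

lemma four_count {m : ℕ} (h : m = 4) : {i : ZMod m | ¬ 2 ∣ (i + 2).val}.ncard = 2 := by
  subst h
  exact four_count0

variable {K : Type*} [Field K] [Finite K] [CharP K 2]

/-- Powers of an element of order three. -/
lemma c_pow (c : K) (hc3 : c ^ 3 = 1) (n : ℕ) :
    c ^ 2 ^ n = if n % 2 = 0 then c else c ^ 2 := by
  induction n with
  | zero => simp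
  | succ n ih =>
    rw [pow_succ, pow_mul, ih]
    by_cases h : n % 2 = 0
    · have : ¬ (n + 1) % 2 = 0 := by omega
      simp [h, this]
    · have : (n + 1) % 2 = 0 := by omega
      simp only [h, this, if_true, if_false]
      linear_combination c * hc3

lemma count0 {m k : ℕ} [NeZero m] (hm : 4 ≤ m) (hq : Nat.card K = 2 ^ m) (hk : Nat.gcd k m = 1)
    (β : K) (hβ : β ≠ 0) (hno : ∀ z : K, z ^ (2 ^ k + 1) ≠ β) :
    2 * {t : ZMod m × K × K | C1 (frobSys hm hq hk) 0 β t.1 t.2.1 t.2.2}.ncard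
      = 3 * m * (2 ^ m - 1) ∧
    {t : ZMod m × K × K | C2 (frobSys hm hq hk) 0 β t.1 t.2.1 t.2.2}.ncard
      = if m = 4 then 6 * (2 ^ m - 1) else 0 := by
  set Φ := frobSys hm hq hk with hΦ
  set N := 2 ^ k + 1 with hN
  have hN0 : N ≠ 0 := Nat.succ_ne_zero _
  obtain ⟨hg, h2m, hk2⟩ : Nat.gcd N (Nat.card K - 1) = 3 ∧ 2 ∣ m ∧ k % 2 = 1 := by
    rw [hq]
    rcases gcd_cases hk with h | h
    · exfalso
      rw [← hq] at h
      obtain ⟨z, -, hz⟩ := pow_range h β hβ (by rw [Nat.div_one]; exact pow_Q β hβ)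
      exact hno z hz
    · exact h
  have h3Q : 3 ∣ Nat.card K - 1 := hg ▸ Nat.gcd_dvd_right _ _
  set r := (Nat.card K - 1) / 3 with hr
  set c := β ^ r with hc
  have hc0 : c ≠ 0 := pow_ne_zero _ hβ
  have hc3 : c ^ 3 = 1 := by
    rw [hc, ← pow_mul, hr, Nat.div_mul_cancel h3Q, pow_Q β hβ]
  have hc1 : c ≠ 1 := by
    intro h
    obtain ⟨z, -, hz⟩ := pow_range hg β hβ h
    exact hno z hz
  have hcc : c ^ 2 ≠ c := by
    intro h
    apply hc1
    apply mul_left_cancel₀ hc0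
    linear_combination h
  have hcn : ∀ n : ℕ, (c ^ 2 ^ n = c ↔ 2 ∣ n) ∧ (c * c ^ 2 ^ n = 1 ↔ ¬ 2 ∣ n) := by
    intro n
    rw [c_pow c hc3, Nat.dvd_iff_mod_eq_zero]
    by_cases h : n % 2 = 0
    · simp only [h, if_true, true_and, not_true, iff_false]
      intro h5
      apply hc1
      linear_combination hc3 - c * h5
    · simp only [h, if_false, not_false_iff, iff_true, iff_false]
      refine ⟨hcc, ?_⟩
      linear_combination hc3
  have he1 : ∀ z : K, Φ.e 1 z * z = z ^ N := by
    intro z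
    have := frobSys_nat hm hq hk 1 z
    push_cast at this
    rw [hΦ, this, hN, pow_succ, mul_one]
  have he3 : ∀ z : K, Φ.e 3 z * Φ.e 2 z = (Φ.e 2 z) ^ N := by
    intro z
    rw [← he1, ← Φ.e_add]
    norm_num
  have hei : ∀ i, (Φ.e i β) ^ r = c ^ 2 ^ (k * i.val) := by
    intro i
    rw [hΦ, frobSys_e, hc, ← pow_mul, ← pow_mul, mul_comm]
  have hpar : ∀ n : ℕ, 2 ∣ k * n ↔ 2 ∣ n := by
    intro n
    rw [Nat.prime_two.dvd_mul]
    constructor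
    · rintro (h | h)
      · omega
      · exact h
    · exact Or.inr
  have hz : ∀ z : K, z ≠ 0 → (z ^ N) ^ r = 1 := fun z hz => pow_nofib hg (z ^ N) z hz rfl
  have hen : ∀ i (z : K), z ≠ 0 → Φ.e i z ≠ 0 := fun i z hz => (map_ne_zero _).2 hz
  constructor
  · have key : ∀ i (a d : K), a ≠ 0 →
        (C1 Φ 0 β i a d ↔ d ^ N = (Φ.e 2 a) ^ N * Φ.e i β / β) := by
      intro i a d ha
      have hw : (Φ.e 2 a) ^ N * Φ.e i β / β ≠ 0 :=
        div_ne_zero (mul_ne_zero (pow_ne_zero _ (hen _ _ ha)) (hen _ _ hβ)) hβ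
      simp only [C1, he1, he3, map_zero, zero_mul, mul_zero, and_true, eq_div_iff hβ]
      constructor
      · rintro ⟨-, -, h⟩
        rw [h, mul_comm]
      · intro h
        refine ⟨ha, ?_, by rw [← h, mul_comm]⟩
        rintro rfl
        rw [← eq_div_iff hβ, zero_pow hN0] at h
        exact hw h.symm
    have hchi : ∀ i (a : K), a ≠ 0 →
        (((Φ.e 2 a) ^ N * Φ.e i β / β) ^ r = 1 ↔ 2 ∣ i.val) := by
      intro i a ha
      rw [div_pow, mul_pow, hz _ (hen _ _ ha), one_mul, hei, ← hc, div_eq_one_iff_eq hc0,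
        (hcn _).1, hpar]
    rw [ncard_fib2 (C1 Φ 0 β) {i : ZMod m | 2 ∣ i.val} 3]
    · have := cnt h2m
      rw [hq]
      calc 2 * (3 * (2 ^ m - 1) * {i : ZMod m | 2 ∣ i.val}.ncard)
          = 3 * (2 * {i : ZMod m | 2 ∣ i.val}.ncard) * (2 ^ m - 1) := by ring
        _ = _ := by rw [this]
    · intro i d h
      exact h.1 rfl
    · intro i hi a ha
      rw [← pow_fib hN0 hg ((Φ.e 2 a) ^ N * Φ.e i β / β)
        (div_ne_zero (mul_ne_zero (pow_ne_zero _ (hen _ _ ha)) (hen _ _ hβ)) hβ)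
        ((hchi i a ha).2 hi)]
      congr 1
      ext d
      exact key i a d ha
    · intro i hi a d h
      apply hi
      have ha := h.1
      rw [key i a d ha] at h
      apply (hchi i a ha).1
      apply pow_nofib hg _ d _ h
      rintro rfl
      rw [zero_pow hN0] at h
      exact div_ne_zero (mul_ne_zero (pow_ne_zero _ (hen _ _ ha)) (hen _ _ hβ)) hβ h.symm
  · split_ifs with h4
    · have hnz : ∀ i (b : K), b ≠ 0 → (Φ.e 2 b) ^ N / (β * Φ.e (i + 2) β) ≠ 0 := fun i b hb =>
        div_ne_zero (pow_ne_zero _ (hen _ _ hb)) (mul_ne_zero hβ (hen _ _ hβ))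
      have key : ∀ i (b d : K), b ≠ 0 →
          (C2 Φ 0 β i b d ↔ d ^ N = (Φ.e 2 b) ^ N / (β * Φ.e (i + 2) β)) := by
        intro i b d hb
        have hbe : β * Φ.e (i + 2) β ≠ 0 := mul_ne_zero hβ (hen _ _ hβ)
        simp only [C2, he1, he3, true_and]
        constructor
        · rintro ⟨-, -, -, h⟩
          rw [eq_div_iff hbe, ← h]
          ring
        · intro h
          refine ⟨h4, hb, ?_, ?_⟩
          · rintro rfl
            rw [zero_pow hN0] at h
            exact hnz i b hb h.symm
          · rw [eq_div_iff hbe] at h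
            rw [← h]
            ring
      have hchi : ∀ i (b : K), b ≠ 0 →
          (((Φ.e 2 b) ^ N / (β * Φ.e (i + 2) β)) ^ r = 1 ↔ ¬ 2 ∣ (i + 2).val) := by
        intro i b hb
        rw [div_pow, mul_pow, hz _ (hen _ _ hb), hei, ← hc, ← hpar, ← (hcn _).2,
          one_div, inv_eq_one]
      have hT : {i : ZMod m | ¬ 2 ∣ (i + 2).val}.ncard = 2 := by
        exact four_count h4
      rw [ncard_fib2 (C2 Φ 0 β) {i : ZMod m | ¬ 2 ∣ (i + 2).val} 3, hT, hq]
      · ring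
      · intro i d h
        exact h.2.2.1 rfl
      · intro i hi b hb
        rw [← pow_fib hN0 hg _ (hnz i b hb) ((hchi i b hb).2 hi)]
        congr 1
        ext d
        exact key i b d hb
      · intro i hi b d h
        apply hi
        have hb := h.2.2.1
        rw [key i b d hb] at h
        apply (hchi i b hb).1
        apply pow_nofib hg _ d _ h
        rintro rfl
        rw [zero_pow hN0] at h
        exact hnz i b hb h.symm
    · have : {t : ZMod m × K × K | C2 Φ 0 β t.1 t.2.1 t.2.2} = ∅ := by
        ext t
        simp [C2, h4]
      rw [this, Set.ncard_empty]

end CountC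

end Tani
/-- The orders of the automorphism groups of an APN Taniguchi function `f_{k,α,β}` on
`F_{2^m} × F_{2^m}` for `m ≥ 4`.  With `β' = β·α^(-(2^(m-k)+1))` and
`u₀ = min {u ≥ 1 : β'^(2^u) = β'}`:
if `α ≠ 0` then `|Aut_EL| = m(2^m-1)/u₀` and `|Aut| = m·2^(2m)·(2^m-1)/u₀`;
if `α = 0` and `m = 4` then `|Aut_EL| = 3m(2^m-1)` and `|Aut| = 3m·2^(2m)·(2^m-1)`;
if `α = 0` and `m ≥ 5` then `|Aut_EL| = (3/2)m(2^m-1)` and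
`|Aut| = 3m·2^(2m-1)·(2^m-1)`.  (The fractions are stated multiplicatively.) -/
theorem taniguchi_automorphism_group_order (m k : ℕ) (hm : 4 ≤ m) (hk : 0 < k)
    (hkm : k < m) (hgcd : Nat.gcd k m = 1) (α β : GaloisField 2 m) (hβ : β ≠ 0)
    (hAPN : ∀ x : GaloisField 2 m, x ^ (2 ^ k + 1) + α * x + β ≠ 0) :
    (α ≠ 0 →
      sInf {u : ℕ | 0 < u ∧
            (β / α ^ (2 ^ (m - k) + 1)) ^ (2 ^ u) = β / α ^ (2 ^ (m - k) + 1)} *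
          (AutELSet (taniguchi k α β)).ncard = m * (2 ^ m - 1) ∧
      sInf {u : ℕ | 0 < u ∧
            (β / α ^ (2 ^ (m - k) + 1)) ^ (2 ^ u) = β / α ^ (2 ^ (m - k) + 1)} *
          (AutSet (taniguchi k α β)).ncard = m * 2 ^ (2 * m) * (2 ^ m - 1)) ∧
    (α = 0 → m = 4 →
      (AutELSet (taniguchi k α β)).ncard = 3 * m * (2 ^ m - 1) ∧
      (AutSet (taniguchi k α β)).ncard = 3 * m * 2 ^ (2 * m) * (2 ^ m - 1)) ∧
    (α = 0 → 5 ≤ m →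
      2 * (AutELSet (taniguchi k α β)).ncard = 3 * m * (2 ^ m - 1) ∧
      (AutSet (taniguchi k α β)).ncard = 3 * m * 2 ^ (2 * m - 1) * (2 ^ m - 1)) := by
  have hm0 : m ≠ 0 := by omega
  have : NeZero m := ⟨hm0⟩
  have hq : Nat.card (GaloisField 2 m) = 2 ^ m := GaloisField.card 2 m hm0
  have hd : Module.finrank (ZMod 2) (GaloisField 2 m) = m := GaloisField.finrank 2 hm0
  have he1 : ∀ z : GaloisField 2 m, (Tani.frobSys hm hq hgcd).e 1 z = z ^ 2 ^ k := by
    intro z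
    have := Tani.frobSys_nat hm hq hgcd 1 z
    push_cast at this
    rw [this, mul_one]
  have hroot : ∀ z : GaloisField 2 m, (Tani.frobSys hm hq hgcd).e 1 z * z + α * z + β ≠ 0 := by
    intro z
    rw [he1, ← pow_succ]
    exact hAPN z
  rw [Tani.taniguchi_eq hm hq hgcd, Tani.aut_ncard _ α β hm hd hroot,
    Tani.autEL_ncard _ α β hm hd hβ]
  refine ⟨?_, ?_, ?_⟩
  · intro hα
    have hs : (Tani.frobSys hm hq hgcd).e 1 (α ^ 2 ^ (m - k)) = α := by
      rw [he1, ← pow_mul, ← pow_add, Nat.sub_add_cancel hkm.le]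
      have := Tani.pw_mod hq α (a := m) (b := 0) (by simp)
      simpa using this
    rw [Tani.countA _ α β _ hβ hα hs, Tani.countA2 _ α β hα, hq, ← pow_succ, add_zero]
    obtain ⟨h1, h2⟩ := Tani.u0_spec hm hq hgcd (β / α ^ (2 ^ (m - k) + 1))
    have h3 := Tani.cnt h1
    simp only [Tani.frobSys_e, h2]
    generalize sInf {u : ℕ | 0 < u ∧
      (β / α ^ (2 ^ (m - k) + 1)) ^ (2 ^ u) = β / α ^ (2 ^ (m - k) + 1)} = u at h3 ⊢
    generalize {i : ZMod m | u ∣ i.val}.ncard = n at h3 ⊢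
    generalize 2 ^ m - 1 = Q
    generalize 2 ^ (2 * m) = R
    constructor
    · rw [← h3]; ring
    · rw [← h3]; ring
  · intro hα h4
    subst hα
    have hno : ∀ z : GaloisField 2 m, z ^ (2 ^ k + 1) ≠ β := by
      intro z hz
      apply hAPN z
      rw [hz, zero_mul, add_zero, CharTwo.add_self_eq_zero]
    obtain ⟨h1, h2⟩ := Tani.count0 hm hq hgcd β hβ hno
    rw [h2, if_pos h4]
    generalize Set.ncard _ = X at h1 ⊢
    have h5 : X + 6 * (2 ^ m - 1) = 3 * m * (2 ^ m - 1) := by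
      subst h4
      omega
    refine ⟨h5, ?_⟩
    rw [h5]
    ring
  · intro hα h4
    subst hα
    have hno : ∀ z : GaloisField 2 m, z ^ (2 ^ k + 1) ≠ β := by
      intro z hz
      apply hAPN z
      rw [hz, zero_mul, add_zero, CharTwo.add_self_eq_zero]
    obtain ⟨h1, h2⟩ := Tani.count0 hm hq hgcd β hβ hno
    rw [h2, if_neg (by omega), add_zero]
    refine ⟨h1, ?_⟩
    generalize Set.ncard _ = X at h1 ⊢
    have h6 : 2 ^ (2 * m) = 2 ^ (2 * m - 1) * 2 := by
      rw [← pow_succ]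
      congr 1
      omega
    rw [h6, mul_assoc, h1]
    ring
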